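/- For each i = 1, …, n−1, there exists a geodesic tube of type ω_i∨ whose hyperbolic generator w is straight and of length ((ω_i∨, α_i∨)/(ω_i∨, ω_i∨))·⟨2ρ, ω_i∨⟩. -/

import Mathlib

open scoped RealInnerProductSpace

noncomputable section

/-- The ambient Euclidean space of rank `m`.  Via the fixed `W`-invariant inner product we
identify the space `V` containing the root system with its dual `V*`; the affine space `A`
underlying `V*` is then the Euclidean space itself. -/
abbrev E (m : ℕ) := EuclideanSpace ℝ (Fin m)

variable {m : ℕ}

/-- The coroot `α∨ = 2α/(α,α)` of a vector `α` (under the identification of `V` with `V*`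
given by the invariant inner product). -/
def coroot (α : E m) : E m := (2 / ⟪α, α⟫) • α

/-- The affine reflection `s_{α,k}(x) = x - (⟨α,x⟩ - k) α∨` as a function. -/
def affReflFun (α : E m) (k : ℤ) : E m → E m := fun x => x - (⟪α, x⟫ - (k : ℝ)) • coroot α

lemma affReflFun_involutive (α : E m) (k : ℤ) : Function.Involutive (affReflFun α k) := by
  intro x
  by_cases h : α = 0
  · simp [affReflFun, coroot, h]
  · have hαα : ⟪α, α⟫ ≠ (0:ℝ) := (inner_self_ne_zero (𝕜 := ℝ)).mpr h
    have h2 : ⟪α, coroot α⟫ = (2:ℝ) := by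
      unfold coroot
      rw [real_inner_smul_right, div_mul_cancel₀ _ hαα]
    have key : ∀ y : E m, ∀ s : ℝ, ⟪α, y - s • coroot α⟫ = ⟪α, y⟫ - 2 * s := by
      intro y s
      rw [inner_sub_right, real_inner_smul_right, h2]
      ring
    show affReflFun α k (x - (⟪α, x⟫ - (k:ℝ)) • coroot α) = x
    unfold affReflFun
    rw [key]
    rw [sub_sub, ← add_smul]
    rw [show (⟪α, x⟫ - (k:ℝ)) + (⟪α, x⟫ - 2 * (⟪α, x⟫ - (k:ℝ)) - (k:ℝ)) = 0 by ring]
    simp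

/-- The affine reflection `s_{α,k}` as a permutation of the affine space. -/
def affRefl (α : E m) (k : ℤ) : Equiv.Perm (E m) := (affReflFun_involutive α k).toPerm

/-- The affine Weyl group of a set of roots `Φ`: the group generated by all affine
reflections `s_{α,k}`, `α ∈ Φ`, `k ∈ ℤ`. -/
def Waff (Φ : Set (E m)) : Subgroup (Equiv.Perm (E m)) :=
  Subgroup.closure {w | ∃ α ∈ Φ, ∃ k : ℤ, w = affRefl α k}

/-- `Φ` is a reduced (crystallographic) root system spanning the ambient space. -/
structure IsRootSystem (Φ : Set (E m)) : Prop where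
  finite : Φ.Finite
  ne_zero : ∀ α ∈ Φ, α ≠ (0 : E m)
  span_eq_top : Submodule.span ℝ Φ = ⊤
  reflect_mem : ∀ α ∈ Φ, ∀ β ∈ Φ, β - ⟪α, β⟫ • coroot α ∈ Φ
  crystallographic : ∀ α ∈ Φ, ∀ β ∈ Φ, ∃ z : ℤ, ⟪α, coroot β⟫ = (z : ℝ)
  reduced : ∀ α ∈ Φ, ∀ t : ℝ, t • α ∈ Φ → t = 1 ∨ t = -1

/-- `B` is a system of simple roots of `Φ`. -/
structure IsSimpleSystem (Φ : Set (E m)) (B : Fin m → E m) : Prop where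
  mem : ∀ i, B i ∈ Φ
  indep : LinearIndependent ℝ B
  decomp : ∀ α ∈ Φ, (∃ c : Fin m → ℤ, α = ∑ j, (c j : ℝ) • B j ∧ ∀ j, 0 ≤ c j) ∨
                    (∃ c : Fin m → ℤ, α = ∑ j, (c j : ℝ) • B j ∧ ∀ j, c j ≤ 0)

/-- `ω` is the system of fundamental coweights relative to the simple roots `B`,
i.e. `⟨α_i, ω_j∨⟩ = δ_{ij}`. -/
def IsFundamentalCoweights (B ω : Fin m → E m) : Prop :=
  ∀ i j, ⟪B i, ω j⟫ = if i = j then (1 : ℝ) else 0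

/-- The wall `H_{α,k} = {x : ⟨α,x⟩ = k}`. -/
def wall (α : E m) (k : ℤ) : Set (E m) := {x | ⟪α, x⟫ = (k : ℝ)}

/-- The union of all walls of the root system `Φ`. -/
def allWalls (Φ : Set (E m)) : Set (E m) := ⋃ α ∈ Φ, ⋃ k : ℤ, wall α k

/-- An alcove: a connected component of the complement of the union of all walls. -/
def IsAlcove (Φ : Set (E m)) (C : Set (E m)) : Prop :=
  ∃ x ∈ (allWalls Φ)ᶜ, C = connectedComponentIn (allWalls Φ)ᶜ x

/-- The set `𝒲` of walls removed when forming geodesic tubes of direction `β∨`: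
all walls `H_{α,k}` with `⟨α, β∨⟩ = 0` (equivalently `α ∈ Φ_I`). -/
def tubeWalls (Φ : Set (E m)) (β : E m) : Set (E m) :=
  ⋃ α ∈ {α ∈ Φ | ⟪α, β⟫ = (0:ℝ)}, ⋃ k : ℤ, wall α k

/-- A geodesic tube of direction `β∨`: a connected component of `A ∖ ⋃𝒲`. -/
def IsGeodesicTube (Φ : Set (E m)) (β : E m) (T : Set (E m)) : Prop :=
  ∃ x ∈ (tubeWalls Φ β)ᶜ, T = connectedComponentIn (tubeWalls Φ β)ᶜ x

/-- `d_γ = inf_x d(x, γx)`. -/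
def minDisp (f : E m → E m) : ℝ := ⨅ x, dist x (f x)

/-- `Min(γ) = {x : d(x,γx) = d_γ}`. -/
def minSet (f : E m → E m) : Set (E m) := {x | dist x (f x) = minDisp f}

/-- A hyperbolic isometry: semisimple (`Min` nonempty) with `d_γ > 0`. -/
def IsHyperbolic (f : E m → E m) : Prop := (minSet f).Nonempty ∧ 0 < minDisp f

/-- `v` is the vector by which `γ` translates its min set. -/
def HasTransVec (f : E m → E m) (v : E m) : Prop := ∀ x ∈ minSet f, f x = x + v

/-- `x` is the barycenter of the polysimplex `s`: the average of the vertices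
(extreme points of the closure) of `s`. -/
def IsBarycenter (s : Set (E m)) (x : E m) : Prop :=
  ∃ F : Finset (E m), (F : Set (E m)) = Set.extremePoints ℝ (closure s) ∧ F.Nonempty ∧
    x = (F.card : ℝ)⁻¹ • ∑ y ∈ F, y

/-- The centerline `ℒ = x + ℝ β∨`. -/
def centerline (x β : E m) : Set (E m) := {p | ∃ t : ℝ, p = x + t • β}


/-- The finite Weyl group `W`, generated by the reflections `s_{α,0}`. -/
def W0 (Φ : Set (E m)) : Subgroup (Equiv.Perm (E m)) :=
  Subgroup.closure {w | ∃ α ∈ Φ, w = affRefl α 0}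

/-- `α̃` is the highest root of `Φ` relative to the simple system `B`. -/
def IsHighestRoot (Φ : Set (E m)) (B : Fin m → E m) (αh : E m) : Prop :=
  αh ∈ Φ ∧ ∀ α ∈ Φ, ∃ c : Fin m → ℝ, (∀ j, 0 ≤ c j) ∧ αh - α = ∑ j, c j • B j

/-- The standard Coxeter generating set `{s_0} ∪ S` of the affine Weyl group, where
`s_0 = s_{-α̃,1}` and `s_i = s_{α_i,0}`. -/
def SAff (B : Fin m → E m) (αh : E m) : Set (Equiv.Perm (E m)) :=
  {w | (∃ i, w = affRefl (B i) 0) ∨ w = affRefl (-αh) 1}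

/-- Word length with respect to a generating set `S` of a group. -/
def len {G : Type*} [Group G] (S : Set G) (w : G) : ℕ :=
  sInf {k | ∃ l : List G, (∀ g ∈ l, g ∈ S) ∧ l.length = k ∧ l.prod = w}

/-- A straight element: `ℓ(w^k) = k ℓ(w)` for all `k ∈ ℕ`. -/
def IsStraight {G : Type*} [Group G] (S : Set G) (w : G) : Prop :=
  ∀ k : ℕ, len S (w ^ k) = k * len S w

/-- `P` is the set of positive roots of `Φ` relative to `B`. -/
def IsPositiveSystem (Φ : Set (E m)) (B : Fin m → E m) (P : Finset (E m)) : Prop :=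
  (P : Set (E m)) = {α ∈ Φ | ∃ c : Fin m → ℝ, (∀ j, 0 ≤ c j) ∧ α = ∑ j, c j • B j}

/-- `w` is the hyperbolic generator of the geodesic tube `T` with direction vector `β`:
the hyperbolic stabilizer of `T` in `W^aff` whose translation vector is the minimal
positive multiple of `β`. -/
def IsHypGenerator (Φ : Set (E m)) (β : E m) (T : Set (E m)) (w : Equiv.Perm (E m)) : Prop :=
  (w ∈ Waff Φ ∧ IsHyperbolic (w : E m → E m) ∧ (w : E m → E m) '' T = T) ∧
  ∃ c : ℝ, 0 < c ∧ HasTransVec (w : E m → E m) (c • β) ∧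
    ∀ w' : Equiv.Perm (E m),
      (w' ∈ Waff Φ ∧ IsHyperbolic (w' : E m → E m) ∧ (w' : E m → E m) '' T = T) →
      ∀ c' : ℝ, HasTransVec (w' : E m → E m) (c' • β) → 0 < c' → c ≤ c'


/-! ## Basic computations with affine reflections -/

namespace Tube

lemma affRefl_apply (α : E m) (k : ℤ) (x : E m) :
    affRefl α k x = x - (⟪α, x⟫ - (k : ℝ)) • coroot α := rfl

lemma affRefl_mul_self (α : E m) (k : ℤ) : affRefl α k * affRefl α k = 1 := by
  ext1 x
  exact affReflFun_involutive α k x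

lemma affRefl_inv (α : E m) (k : ℤ) : (affRefl α k)⁻¹ = affRefl α k :=
  inv_eq_of_mul_eq_one_left (affRefl_mul_self α k)

lemma inner_coroot_self {α : E m} (h : α ≠ 0) : ⟪α, coroot α⟫ = (2 : ℝ) := by
  have hαα : ⟪α, α⟫ ≠ (0:ℝ) := (inner_self_ne_zero (𝕜 := ℝ)).mpr h
  unfold coroot
  rw [real_inner_smul_right, div_mul_cancel₀ _ hαα]

lemma coroot_neg (α : E m) : coroot (-α) = - coroot α := by
  simp [coroot]

lemma affRefl_neg (α : E m) (k : ℤ) : affRefl (-α) (-k) = affRefl α k := by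
  ext1 x
  rw [affRefl_apply, affRefl_apply, coroot_neg, inner_neg_left]
  push_cast
  module

lemma inner_affRefl_self {α : E m} (h : α ≠ 0) (k : ℤ) (x : E m) :
    ⟪α, affRefl α k x⟫ = 2 * (k : ℝ) - ⟪α, x⟫ := by
  rw [affRefl_apply, inner_sub_right, real_inner_smul_right, inner_coroot_self h]
  ring

lemma coroot_map (L : E m ≃ₗᵢ[ℝ] E m) (α : E m) : coroot (L α) = L (coroot α) := by
  simp [coroot]

/-- The linear reflection as a linear isometry. -/
def linRefl (α : E m) : E m ≃ₗᵢ[ℝ] E m := (ℝ ∙ α)ᗮ.reflection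

lemma linRefl_apply (α x : E m) : linRefl α x = x - ⟪α, x⟫ • coroot α := by
  unfold linRefl coroot
  rw [Submodule.reflection_orthogonal_apply, Submodule.reflection_singleton_apply]
  simp only [RCLike.ofReal_real_eq_id, id, real_inner_self_eq_norm_sq]
  module

lemma linRefl_symm (α : E m) : (linRefl α).symm = linRefl α := by
  unfold linRefl; exact Submodule.reflection_symm

/-- A finite set of vectors stable under its reflections, with the integrality condition. -/
structure SubRS (F : Finset (E m)) : Prop where
  ne : ∀ α ∈ F, α ≠ 0
  refl : ∀ α ∈ F, ∀ β ∈ F, linRefl α β ∈ F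
  cryst : ∀ α ∈ F, ∀ β ∈ F, ∃ z : ℤ, ⟪α, coroot β⟫ = (z : ℝ)

lemma SubRS.neg {F : Finset (E m)} (h : SubRS F) {α : E m} (hα : α ∈ F) : -α ∈ F := by
  have := h.refl α hα α hα
  have h0 := h.ne α hα
  have hαα : ⟪α, α⟫ ≠ (0:ℝ) := (inner_self_ne_zero (𝕜 := ℝ)).mpr h0
  rw [linRefl_apply] at this
  convert this using 1
  unfold coroot
  rw [smul_smul, mul_div_cancel₀ _ hαα]
  module

/-- The coroot lattice. -/
def Q (F : Finset (E m)) : AddSubgroup (E m) := AddSubgroup.closure {v | ∃ α ∈ F, v = coroot α}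

lemma Q_map {F : Finset (E m)} (L : E m ≃ₗᵢ[ℝ] E m) (hL : ∀ α ∈ F, L α ∈ F) {μ : E m}
    (hμ : μ ∈ Q F) : L μ ∈ Q F := by
  unfold Q at hμ
  induction hμ using AddSubgroup.closure_induction with
  | mem x hx =>
    obtain ⟨α, hα, rfl⟩ := hx
    rw [← coroot_map]
    exact AddSubgroup.subset_closure ⟨_, hL α hα, rfl⟩
  | zero => simp [zero_mem]
  | add x y _ _ hx hy => rw [map_add]; exact add_mem hx hy
  | neg x _ hx => rw [map_neg]; exact neg_mem hx

lemma Q_int {F : Finset (E m)} (h : SubRS F) {μ : E m}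
    (hμ : μ ∈ Q F) : ∀ α ∈ F, ∃ z : ℤ, ⟪α, μ⟫ = (z : ℝ) := by
  unfold Q at hμ
  intro β hβ
  induction hμ using AddSubgroup.closure_induction with
  | mem x hx =>
    obtain ⟨α, hα, rfl⟩ := hx
    exact h.cryst β hβ α hα
  | zero => exact ⟨0, by simp⟩
  | add x y _ _ hx hy =>
    obtain ⟨a, ha⟩ := hx
    obtain ⟨b, hb⟩ := hy
    exact ⟨a + b, by rw [inner_add_right, ha, hb]; push_cast; ring⟩
  | neg x _ hx =>
    obtain ⟨a, ha⟩ := hx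
    exact ⟨-a, by rw [inner_neg_right, ha]; push_cast; ring⟩

/-- The affine form of an element of the affine Weyl group. -/
lemma aff_form {F : Finset (E m)} (h : SubRS F) {g : Equiv.Perm (E m)}
    (hg : g ∈ Waff (F : Set (E m))) :
    ∃ L : E m ≃ₗᵢ[ℝ] E m, ∃ μ ∈ Q F, (L.toLinearEquiv.toEquiv : Equiv.Perm (E m)) ∈ W0 (F : Set (E m)) ∧
      (∀ α ∈ F, L α ∈ F) ∧ (∀ α ∈ F, L.symm α ∈ F) ∧ ∀ x, g x = L x + μ := by
  unfold Waff at hg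
  induction hg using Subgroup.closure_induction with
  | mem x hx =>
    obtain ⟨α, hα, k, rfl⟩ := hx
    refine ⟨linRefl α, k • coroot α, ?_, ?_, h.refl α hα, ?_, ?_⟩
    · have hc : coroot α ∈ Q F := AddSubgroup.subset_closure ⟨α, hα, rfl⟩
      exact zsmul_mem hc k
    · refine Subgroup.subset_closure ⟨α, hα, ?_⟩
      ext1 x
      rw [affRefl_apply]
      show linRefl α x = _
      rw [linRefl_apply]; simp
    · rw [linRefl_symm]; exact h.refl α hα
    · intro x
      rw [affRefl_apply, linRefl_apply, ← Int.cast_smul_eq_zsmul ℝ]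
      module
  | one =>
    refine ⟨LinearIsometryEquiv.refl ℝ _, 0, zero_mem _, one_mem _, fun α hα => hα, fun α hα => hα,
      fun x => ?_⟩
    simp
  | mul a b _ _ ha hb =>
    obtain ⟨L, μ, hμ, hL, h1, h2, h3⟩ := ha
    obtain ⟨L', μ', hμ', hL', h1', h2', h3'⟩ := hb
    refine ⟨L'.trans L, L μ' + μ, add_mem (Q_map L h1 hμ') hμ, mul_mem hL hL',
      fun α hα => h1 _ (h1' _ hα), fun α hα => h2' _ (h2 _ hα), fun x => ?_⟩
    rw [Equiv.Perm.mul_apply, h3', h3, map_add]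
    simp [add_assoc]
  | inv a _ ha =>
    obtain ⟨L, μ, hμ, hL, h1, h2, h3⟩ := ha
    refine ⟨L.symm, - L.symm μ, neg_mem (Q_map L.symm h2 hμ), inv_mem hL, h2, by simpa using h1,
      fun x => ?_⟩
    rw [Equiv.Perm.inv_eq_iff_eq, h3]
    simp

lemma conj_refl {g : Equiv.Perm (E m)} {L : E m ≃ₗᵢ[ℝ] E m} {μ : E m} (hg : ∀ x, g x = L x + μ)
    (α : E m) (k n : ℤ) (hn : (n : ℝ) = k + ⟪L α, μ⟫) :
    g * affRefl α k = affRefl (L α) n * g := by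
  ext1 x
  rw [Equiv.Perm.mul_apply, Equiv.Perm.mul_apply, affRefl_apply, affRefl_apply, hg, hg, coroot_map,
    map_sub, map_smul, inner_add_right, LinearIsometryEquiv.inner_map_map, hn]
  module

/-- Regular points. -/
def Reg (F : Finset (E m)) (x : E m) : Prop := ∀ α ∈ F, ∀ k : ℤ, ⟪α, x⟫ ≠ (k : ℝ)

lemma Reg.map {F : Finset (E m)} (h : SubRS F) {g : Equiv.Perm (E m)}
    (hg : g ∈ Waff (F : Set (E m))) {x : E m} (hx : Reg F x) : Reg F (g x) := by
  obtain ⟨L, μ, hμ, hL, h1, h2, h3⟩ := aff_form h hg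
  intro α hα k hk
  obtain ⟨z, hz⟩ := Q_int h hμ α hα
  rw [h3, inner_add_right, hz] at hk
  refine hx _ (h2 α hα) (k - z) ?_
  rw [← LinearIsometryEquiv.inner_map_map L, LinearIsometryEquiv.apply_symm_apply]
  push_cast
  linarith

/-- Twice the number of walls separating two points. -/
def D (F : Finset (E m)) (x y : E m) : ℤ := ∑ α ∈ F, |⌊⟪α, x⟫⌋ - ⌊⟪α, y⟫⌋|

lemma D_nonneg (F : Finset (E m)) (x y : E m) : 0 ≤ D F x y :=
  Finset.sum_nonneg fun _ _ => abs_nonneg _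

lemma D_comm (F : Finset (E m)) (x y : E m) : D F x y = D F y x :=
  Finset.sum_congr rfl fun _ _ => abs_sub_comm _ _

lemma D_tri (F : Finset (E m)) (x y z : E m) : D F x z ≤ D F x y + D F y z := by
  unfold D
  rw [← Finset.sum_add_distrib]
  exact Finset.sum_le_sum fun _ _ => abs_sub_le _ _ _

lemma D_eq_zero {F : Finset (E m)} {x y : E m} :
    D F x y = 0 ↔ ∀ α ∈ F, ⌊⟪α, x⟫⌋ = ⌊⟪α, y⟫⌋ := by
  unfold D
  rw [Finset.sum_eq_zero_iff_of_nonneg fun _ _ => abs_nonneg _]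
  simp [sub_eq_zero]

lemma D_map {F : Finset (E m)} (h : SubRS F) {g : Equiv.Perm (E m)}
    (hg : g ∈ Waff (F : Set (E m))) (x y : E m) : D F (g x) (g y) = D F x y := by
  obtain ⟨L, μ, hμ, hL, h1, h2, h3⟩ := aff_form h hg
  unfold D
  refine Finset.sum_nbij' (fun α => L.symm α) (fun α => L α) h2 h1 (by simp) (by simp) ?_
  intro α hα
  obtain ⟨z, hz⟩ := Q_int h hμ α hα
  have key : ∀ w, ⌊⟪α, g w⟫⌋ = ⌊⟪L.symm α, w⟫⌋ + z := by
    intro w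
    rw [h3, inner_add_right, hz, Int.floor_add_intCast,
      ← LinearIsometryEquiv.inner_map_map L (L.symm α) w, LinearIsometryEquiv.apply_symm_apply]
  rw [key, key]
  congr 1
  ring

/-- Folding along a separating wall decreases the number of separating walls. -/
lemma D_fold {F : Finset (E m)} (h : SubRS F) {α : E m} (hα : α ∈ F) {k : ℤ} {x y : E m}
    (hx : ⟪α, x⟫ < (k : ℝ)) (hy : (k : ℝ) < ⟪α, y⟫) : D F x (affRefl α k y) < D F x y := by
  have hs : affRefl α k ∈ Waff (F : Set (E m)) := Subgroup.subset_closure ⟨α, hα, k, rfl⟩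
  set t : ℝ := (k - ⟪α, x⟫) / (⟪α, y⟫ - ⟪α, x⟫) with ht
  have hd : 0 < ⟪α, y⟫ - ⟪α, x⟫ := by linarith
  have ht0 : 0 ≤ t := div_nonneg (by linarith) hd.le
  have ht1 : t ≤ 1 := (div_le_one hd).2 (by linarith)
  set z : E m := x + t • (y - x) with hz
  have hin : ∀ β : E m, ⟪β, z⟫ = ⟪β, x⟫ + t * (⟪β, y⟫ - ⟪β, x⟫) := by
    intro β
    rw [hz, inner_add_right, real_inner_smul_right, inner_sub_right]
  have hzk : ⟪α, z⟫ = (k : ℝ) := by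
    rw [hin, ht, div_mul_cancel₀ _ hd.ne']; ring
  have hfix : affRefl α k z = z := by
    rw [affRefl_apply, hzk]; simp
  have e1 : D F z (affRefl α k y) = D F z y := by
    conv_lhs => rw [← hfix]
    exact D_map h hs z y
  have e2 : D F x z + D F z y = D F x y := by
    unfold D
    rw [← Finset.sum_add_distrib]
    refine Finset.sum_congr rfl fun β _ => ?_
    rcases le_total ⟪β, x⟫ ⟪β, y⟫ with hle | hle
    · have a1 : ⟪β, x⟫ ≤ ⟪β, z⟫ := by rw [hin]; nlinarith
      have a2 : ⟪β, z⟫ ≤ ⟪β, y⟫ := by rw [hin]; nlinarith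
      have b1 := Int.floor_mono a1
      have b2 := Int.floor_mono a2
      rw [abs_of_nonpos (by linarith), abs_of_nonpos (by linarith), abs_of_nonpos (by linarith)]
      ring
    · have a1 : ⟪β, z⟫ ≤ ⟪β, x⟫ := by rw [hin]; nlinarith
      have a2 : ⟪β, y⟫ ≤ ⟪β, z⟫ := by rw [hin]; nlinarith
      have b1 := Int.floor_mono a1
      have b2 := Int.floor_mono a2
      rw [abs_of_nonneg (by linarith), abs_of_nonneg (by linarith), abs_of_nonneg (by linarith)]
      ring
  rw [← e2, ← e1]
  unfold D
  rw [← Finset.sum_add_distrib]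
  refine Finset.sum_lt_sum (fun _ _ => abs_sub_le _ _ _) ⟨α, hα, ?_⟩
  have f1 : ⌊⟪α, z⟫⌋ = k := by rw [hzk, Int.floor_intCast]
  have f2 : ⌊⟪α, x⟫⌋ < k := Int.floor_lt.2 hx
  have f3 : ⌊⟪α, affRefl α k y⟫⌋ < k := by
    rw [inner_affRefl_self (h.ne α hα)]
    exact Int.floor_lt.2 (by linarith)
  rw [f1, abs_of_neg (by linarith : ⌊⟪α, x⟫⌋ - k < 0),
    abs_of_pos (by linarith : 0 < k - ⌊⟪α, affRefl α k y⟫⌋), abs_lt]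
  constructor <;> linarith

/-- Transitivity on alcoves. -/
lemma exists_to_alcove {F : Finset (E m)} (h : SubRS F) {x : E m} (hx : Reg F x) (n : ℕ) :
    ∀ y : E m, Reg F y → D F x y ≤ n → ∃ a ∈ Waff (F : Set (E m)), D F x (a y) = 0 := by
  induction n with
  | zero =>
    intro y _ hD
    exact ⟨1, one_mem _, le_antisymm (by simpa using hD) (D_nonneg _ _ _)⟩
  | succ n ih =>
    intro y hy hD
    by_cases h0 : D F x y = 0
    · exact ⟨1, one_mem _, h0⟩
    have : ∃ α ∈ F, ∃ k : ℤ, ⟪α, x⟫ < (k : ℝ) ∧ (k : ℝ) < ⟪α, y⟫ := by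
      rw [D_eq_zero] at h0
      push Not at h0
      obtain ⟨α, hα, hne⟩ := h0
      rcases lt_or_gt_of_ne hne with hlt | hlt
      · exact ⟨α, hα, _, Int.floor_lt.1 hlt,
          lt_of_le_of_ne (Int.floor_le _) (Ne.symm (hy α hα _))⟩
      · refine ⟨-α, h.neg hα, -⌊⟪α, x⟫⌋, ?_, ?_⟩
        · rw [inner_neg_left]
          push_cast
          exact neg_lt_neg (lt_of_le_of_ne (Int.floor_le _) (Ne.symm (hx α hα _)))
        · rw [inner_neg_left]
          push_cast
          exact neg_lt_neg (Int.floor_lt.1 hlt)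
    obtain ⟨α, hα, k, h1, h2⟩ := this
    have hs : affRefl α k ∈ Waff (F : Set (E m)) := Subgroup.subset_closure ⟨α, hα, k, rfl⟩
    have hlt := D_fold h hα h1 h2
    obtain ⟨a, ha, haD⟩ := ih _ (Reg.map h hs hy) (by push_cast at hD; linarith)
    exact ⟨a * affRefl α k, mul_mem ha hs, haD⟩

lemma Reg.of_D {F : Finset (E m)} (h : SubRS F) {x y : E m} (hx : Reg F x) (hD : D F x y = 0) :
    Reg F y := by
  rw [D_eq_zero] at hD
  intro α hα k hk
  have h1 := hD α hα
  have h2 := hD (-α) (h.neg hα)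
  rw [inner_neg_left, inner_neg_left, hk] at h2
  rw [hk, Int.floor_intCast] at h1
  rw [← Int.cast_neg, Int.floor_intCast] at h2
  have a1 := Int.floor_eq_iff.1 h1
  have a2 := Int.floor_eq_iff.1 h2
  push_cast at a2
  exact hx α hα k (by linarith)

end Tube

namespace Tube

/-- The data of the root system, in the form used below. -/
structure Ctx (F : Finset (E m)) (B ω : Fin m → E m) (αh : E m) : Prop extends SubRS F where
  red : ∀ α ∈ F, ∀ t : ℝ, t • α ∈ F → t = 1 ∨ t = -1
  memB : ∀ j, B j ∈ F
  dual : ∀ i j, ⟪B i, ω j⟫ = if i = j then (1 : ℝ) else 0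
  expand : ∀ x, x = ∑ j, ⟪x, ω j⟫ • B j
  int : ∀ α ∈ F, ∀ j, ∃ z : ℤ, ⟪α, ω j⟫ = (z : ℝ)
  sign : ∀ α ∈ F, (∀ j, 0 ≤ ⟪α, ω j⟫) ∨ (∀ j, ⟪α, ω j⟫ ≤ 0)
  hmem : αh ∈ F
  high : ∀ α ∈ F, ∀ j, ⟪α, ω j⟫ ≤ ⟪αh, ω j⟫

/-- Nonnegativity with respect to the simple system. -/
def Pos (ω : Fin m → E m) (α : E m) : Prop := ∀ j, 0 ≤ ⟪α, ω j⟫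

variable {F : Finset (E m)} {B ω : Fin m → E m} {αh : E m}

lemma sum_coeff (hdual : IsFundamentalCoweights B ω) (c : Fin m → ℝ) (k : Fin m) :
    ⟪∑ j, c j • B j, ω k⟫ = c k := by
  rw [sum_inner]
  simp [real_inner_smul_left, hdual _ k]

lemma mkCtx (hΦ : IsRootSystem (F : Set (E m))) (hB : IsSimpleSystem (F : Set (E m)) B)
    (hω : IsFundamentalCoweights B ω) (hαh : IsHighestRoot (F : Set (E m)) B αh) :
    Ctx F B ω αh where
  ne := fun α hα => hΦ.ne_zero α hα
  refl := fun α hα β hβ => by rw [linRefl_apply]; exact hΦ.reflect_mem α hα β hβ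
  cryst := fun α hα β hβ => hΦ.crystallographic α hα β hβ
  red := fun α hα t ht => hΦ.reduced α hα t ht
  memB := hB.mem
  dual := hω
  expand := by
    intro x
    have hspan : Submodule.span ℝ (Set.range B) = ⊤ :=
      hB.indep.span_eq_top_of_card_eq_finrank' (by simp)
    have hx : x ∈ Submodule.span ℝ (Set.range B) := hspan ▸ Submodule.mem_top
    obtain ⟨c, rfl⟩ := (Submodule.mem_span_range_iff_exists_fun ℝ).1 hx
    exact Finset.sum_congr rfl fun j _ => by rw [sum_coeff hω]
  int := by
    intro α hα j
    rcases hB.decomp α hα with ⟨c, rfl, _⟩ | ⟨c, rfl, _⟩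
    · exact ⟨c j, sum_coeff hω (fun j => (c j : ℝ)) j⟩
    · exact ⟨c j, sum_coeff hω (fun j => (c j : ℝ)) j⟩
  sign := by
    intro α hα
    rcases hB.decomp α hα with ⟨c, rfl, hc⟩ | ⟨c, rfl, hc⟩
    · left; intro j; rw [sum_coeff hω (fun j => (c j : ℝ)) j]; exact_mod_cast hc j
    · right; intro j; rw [sum_coeff hω (fun j => (c j : ℝ)) j]; exact_mod_cast hc j
  hmem := hαh.1
  high := by
    intro α hα j
    obtain ⟨c, hc, he⟩ := hαh.2 α hα
    have : ⟪αh - α, ω j⟫ = c j := by rw [he, sum_coeff hω]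
    rw [inner_sub_left] at this
    linarith [hc j]

lemma Ctx.inner_expand (h : Ctx F B ω αh) (x y : E m) :
    ⟪x, y⟫ = ∑ j, ⟪x, ω j⟫ * ⟪B j, y⟫ := by
  conv_lhs => rw [h.expand x]
  rw [sum_inner]
  simp [real_inner_smul_left]

lemma Ctx.eq_of_coeff (h : Ctx F B ω αh) {x y : E m} (hxy : ∀ j, ⟪x, ω j⟫ = ⟪y, ω j⟫) : x = y := by
  rw [h.expand x, h.expand y]
  exact Finset.sum_congr rfl fun j _ => by rw [hxy]

lemma Ctx.pos_or_neg (h : Ctx F B ω αh) {α : E m} (hα : α ∈ F) : Pos ω α ∨ Pos ω (-α) := by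
  rcases h.sign α hα with h1 | h1
  · exact Or.inl h1
  · exact Or.inr fun j => by rw [inner_neg_left]; linarith [h1 j]

lemma Ctx.pos_of_coeff (h : Ctx F B ω αh) {α : E m} (hα : α ∈ F) {j : Fin m}
    (hj : 0 < ⟪α, ω j⟫) : Pos ω α := by
  rcases h.sign α hα with h1 | h1
  · exact h1
  · exact absurd (h1 j) (not_le.2 hj)

lemma Ctx.coeff_refl (h : Ctx F B ω αh) (α : E m) (j k : Fin m) (hjk : k ≠ j) :
    ⟪linRefl (B j) α, ω k⟫ = ⟪α, ω k⟫ := by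
  rw [linRefl_apply, inner_sub_left, real_inner_smul_left, coroot, real_inner_smul_left, h.dual,
    if_neg (Ne.symm hjk)]
  simp

lemma Ctx.exists_other (h : Ctx F B ω αh) {α : E m} (hα : α ∈ F) (hp : Pos ω α) {j : Fin m}
    (hne : α ≠ B j) : ∃ k, k ≠ j ∧ 0 < ⟪α, ω k⟫ := by
  by_contra hcon
  push Not at hcon
  have he : α = ⟪α, ω j⟫ • B j := by
    refine h.eq_of_coeff fun k => ?_
    rw [real_inner_smul_left, h.dual]
    by_cases hk : k = j
    · subst hk; simp
    · rw [if_neg (Ne.symm hk), le_antisymm (hcon k hk) (hp k)]; simp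
  have := h.red (B j) (h.memB j) ⟪α, ω j⟫ (he ▸ hα)
  rcases this with h1 | h1
  · rw [h1, one_smul] at he; exact hne he
  · linarith [hp j]

lemma Ctx.simple_refl_pos (h : Ctx F B ω αh) {α : E m} (hα : α ∈ F) (hp : Pos ω α) {j : Fin m}
    (hne : α ≠ B j) : Pos ω (linRefl (B j) α) := by
  obtain ⟨k, hk, hpos⟩ := h.exists_other hα hp hne
  exact h.pos_of_coeff (h.refl _ (h.memB j) _ hα) (j := k) (by rw [h.coeff_refl _ _ _ hk]; exact hpos)

/-- The base alcove (the one whose walls carry the generators of `SAff`). -/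
def InC (F : Finset (E m)) (ω : Fin m → E m) (x : E m) : Prop :=
  ∀ α ∈ F, Pos ω α → -1 < ⟪α, x⟫ ∧ ⟪α, x⟫ < 0

lemma Ctx.cases_InC (h : Ctx F B ω αh) {x y : E m} {α : E m} (hα : α ∈ F)
    (hx : ∀ β ∈ F, (β = α ∨ β = -α) → Pos ω β → -1 < ⟪β, x⟫ ∧ ⟪β, x⟫ < 0)
    (hy : ∀ β ∈ F, (β = α ∨ β = -α) → Pos ω β → -1 < ⟪β, y⟫ ∧ ⟪β, y⟫ < 0) :
    ⌊⟪α, x⟫⌋ = ⌊⟪α, y⟫⌋ := by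
  rcases h.pos_or_neg hα with hp | hp
  · obtain ⟨a1, a2⟩ := hx α hα (Or.inl rfl) hp
    obtain ⟨b1, b2⟩ := hy α hα (Or.inl rfl) hp
    rw [Int.floor_eq_iff.2 (show ((-1 : ℤ) : ℝ) ≤ ⟪α, x⟫ ∧ ⟪α, x⟫ < ((-1 : ℤ) : ℝ) + 1 by
        push_cast; constructor <;> linarith),
      Int.floor_eq_iff.2 (show ((-1 : ℤ) : ℝ) ≤ ⟪α, y⟫ ∧ ⟪α, y⟫ < ((-1 : ℤ) : ℝ) + 1 by
        push_cast; constructor <;> linarith)]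
  · obtain ⟨a1, a2⟩ := hx (-α) (h.neg hα) (Or.inr rfl) hp
    obtain ⟨b1, b2⟩ := hy (-α) (h.neg hα) (Or.inr rfl) hp
    rw [inner_neg_left] at a1 a2 b1 b2
    rw [Int.floor_eq_iff.2 (show ((0 : ℤ) : ℝ) ≤ ⟪α, x⟫ ∧ ⟪α, x⟫ < ((0 : ℤ) : ℝ) + 1 by
        push_cast; constructor <;> linarith),
      Int.floor_eq_iff.2 (show ((0 : ℤ) : ℝ) ≤ ⟪α, y⟫ ∧ ⟪α, y⟫ < ((0 : ℤ) : ℝ) + 1 by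
        push_cast; constructor <;> linarith)]

lemma Ctx.D_InC (h : Ctx F B ω αh) {x y : E m} (hx : InC F ω x) (hy : InC F ω y) : D F x y = 0 :=
  D_eq_zero.2 fun _ hα => h.cases_InC hα (fun β hβ _ => hx β hβ) (fun β hβ _ => hy β hβ)

lemma Ctx.reg_InC (h : Ctx F B ω αh) {x : E m} (hx : InC F ω x) : Reg F x := by
  intro α hα k hk
  rcases h.pos_or_neg hα with hp | hp
  · obtain ⟨a1, a2⟩ := hx α hα hp
    rw [hk] at a1 a2
    have b1 : (-1 : ℤ) < k := by exact_mod_cast a1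
    have b2 : k < 0 := by exact_mod_cast a2
    omega
  · obtain ⟨a1, a2⟩ := hx (-α) (h.neg hα) hp
    rw [inner_neg_left, hk] at a1 a2
    have b1 : (-1 : ℤ) < -k := by exact_mod_cast a1
    have b2 : -k < 0 := by exact_mod_cast a2
    omega

lemma Ctx.pos_B (h : Ctx F B ω αh) (j : Fin m) : Pos ω (B j) := by
  intro k; rw [h.dual]; split_ifs <;> norm_num

lemma Ctx.pos_high (h : Ctx F B ω αh) : Pos ω αh := by
  intro k
  exact (h.pos_B k k).trans (h.high _ (h.memB k) k)

lemma Ctx.exists_pos_coeff (h : Ctx F B ω αh) {α : E m} (hα : α ∈ F) (hp : Pos ω α) :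
    ∃ j, 0 < ⟪α, ω j⟫ := by
  by_contra hcon
  push Not at hcon
  refine h.ne α hα (h.eq_of_coeff fun j => ?_)
  rw [inner_zero_left]
  exact le_antisymm (hcon j) (hp j)

lemma Ctx.exists_InC (h : Ctx F B ω αh) : ∃ x, InC F ω x := by
  set s : E m := ∑ j, ω j with hs
  have hin : ∀ α, ⟪α, s⟫ = ∑ j, ⟪α, ω j⟫ := fun α => by rw [hs, inner_sum]
  have hpos : ∀ α ∈ F, Pos ω α → 0 < ⟪α, s⟫ := by
    intro α hα hp
    obtain ⟨j, hj⟩ := h.exists_pos_coeff hα hp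
    rw [hin]
    exact Finset.sum_pos' (fun k _ => hp k) ⟨j, Finset.mem_univ _, hj⟩
  have hh : 0 < ⟪αh, s⟫ := hpos _ h.hmem h.pos_high
  refine ⟨(-(⟪αh, s⟫ + 1)⁻¹) • s, fun α hα hp => ?_⟩
  have h1 := hpos α hα hp
  have h2 : ⟪α, s⟫ ≤ ⟪αh, s⟫ := by
    rw [hin, hin]; exact Finset.sum_le_sum fun j _ => h.high α hα j
  rw [real_inner_smul_right, neg_mul, inv_mul_eq_div]
  constructor
  · rw [neg_lt_neg_iff, div_lt_one (by linarith)]; linarith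
  · rw [neg_lt_zero]; positivity

/-- The data attached to a generator. -/
structure GenData (F : Finset (E m)) (x0 : E m) (s : Equiv.Perm (E m)) (γ : E m) (n : ℤ) : Prop where
  mem : γ ∈ F
  eq : s = affRefl γ n
  lo : (n : ℝ) - 1 < ⟪γ, x0⟫
  hi : ⟪γ, x0⟫ < n
  other : ∀ α ∈ F, α ≠ γ → α ≠ -γ → ⌊⟪α, s x0⟫⌋ = ⌊⟪α, x0⟫⌋

lemma Ctx.high_inner_nonneg (h : Ctx F B ω αh) {α : E m} (hp : Pos ω α) :
    0 ≤ ⟪α, αh⟫ := by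
  rw [h.inner_expand]
  refine Finset.sum_nonneg fun j _ => mul_nonneg (hp j) ?_
  have h1 := h.high _ (h.refl _ (h.memB j) _ h.hmem) j
  have hne := h.ne _ (h.memB j)
  have hBB : 0 < ⟪B j, B j⟫ := real_inner_self_pos.2 hne
  rw [linRefl_apply, inner_sub_left, real_inner_smul_left, coroot, real_inner_smul_left, h.dual,
    if_pos rfl, mul_one] at h1
  have h2 : 0 ≤ ⟪B j, αh⟫ * (2 / ⟪B j, B j⟫) := by linarith
  exact nonneg_of_mul_nonneg_left h2 (by positivity)

lemma Ctx.gen_simple (h : Ctx F B ω αh) {x0 : E m} (hx : InC F ω x0) (j : Fin m) :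
    GenData F x0 (affRefl (B j) 0) (B j) 0 where
  mem := h.memB j
  eq := rfl
  lo := by push_cast; linarith [(hx _ (h.memB j) (h.pos_B j)).1]
  hi := by push_cast; linarith [(hx _ (h.memB j) (h.pos_B j)).2]
  other := by
    intro α hα h1 h2
    refine h.cases_InC hα ?_ (fun β hβ _ => hx β hβ)
    intro β hβ hβα hp
    have hne : β ≠ B j := by
      rcases hβα with rfl | rfl
      · exact h1
      · intro hc; exact h2 (by rw [← hc, neg_neg])
    have hp' := h.simple_refl_pos hβ hp hne
    have hm := h.refl _ (h.memB j) _ hβ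
    have he : ⟪β, affRefl (B j) 0 x0⟫ = ⟪linRefl (B j) β, x0⟫ := by
      rw [← LinearIsometryEquiv.inner_map_map (linRefl (B j)) (linRefl (B j) β) x0,
        show linRefl (B j) (linRefl (B j) β) = β from Submodule.reflection_reflection _ _,
        affRefl_apply, linRefl_apply]
      simp
    rw [he]
    exact hx _ hm hp'

lemma Ctx.gen_high (h : Ctx F B ω αh) {x0 : E m} (hx : InC F ω x0) :
    GenData F x0 (affRefl (-αh) 1) (-αh) 1 where
  mem := h.neg h.hmem
  eq := rfl
  lo := by rw [inner_neg_left]; push_cast; linarith [(hx _ h.hmem h.pos_high).2]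
  hi := by rw [inner_neg_left]; push_cast; linarith [(hx _ h.hmem h.pos_high).1]
  other := by
    intro α hα h1 h2
    rw [neg_neg] at h2
    refine h.cases_InC hα ?_ (fun β hβ _ => hx β hβ)
    intro β hβ hβα hp
    have hne : β ≠ αh := by
      rcases hβα with rfl | rfl
      · exact h2
      · intro hc; exact h1 (by rw [← hc, neg_neg])
    obtain ⟨n, hn⟩ := h.cryst β hβ αh h.hmem
    have hhh : 0 < ⟪αh, αh⟫ := real_inner_self_pos.2 (h.ne _ h.hmem)
    have hco : ⟪β, coroot αh⟫ = 2 / ⟪αh, αh⟫ * ⟪β, αh⟫ := by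
      rw [coroot, real_inner_smul_right]
    have hn0 : 0 ≤ n := by
      have : (0 : ℝ) ≤ n := by
        rw [← hn, hco]
        exact mul_nonneg (by positivity) (h.high_inner_nonneg hp)
      exact_mod_cast this
    have hr : linRefl αh β = β - (n : ℝ) • αh := by
      rw [linRefl_apply, ← hn, hco, coroot, smul_smul, real_inner_comm]
      congr 2; ring
    have hrm := h.refl _ h.hmem _ hβ
    rw [hr] at hrm
    have hn1 : n ≤ 1 := by
      by_contra hcon
      push Not at hcon
      have hn2 : (2 : ℝ) ≤ n := by exact_mod_cast hcon
      apply hne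
      refine h.eq_of_coeff fun j => ?_
      have a1 := h.high _ (h.neg hrm) j
      have a2 := h.high _ hβ j
      have a3 := h.pos_high j
      rw [inner_neg_left, inner_sub_left, real_inner_smul_left] at a1
      nlinarith
    have hval : ⟪β, affRefl (-αh) 1 x0⟫ = ⟪β, x0⟫ - (⟪αh, x0⟫ + 1) * n := by
      rw [affRefl_apply, coroot_neg, inner_sub_right, real_inner_smul_right, inner_neg_right, hn,
        inner_neg_left]
      push_cast; ring
    rw [hval]
    have hb := hx β hβ hp
    rcases (by omega : n = 0 ∨ n = 1) with rfl | rfl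
    · simpa using hb
    · have hm' := h.neg hrm
      have hc := hx _ hm' (by
        intro j
        rw [inner_neg_left, inner_sub_left, real_inner_smul_left]
        push_cast
        linarith [h.high _ hβ j])
      rw [inner_neg_left, inner_sub_left, real_inner_smul_left] at hc
      push_cast at hc ⊢
      constructor <;> linarith [hc.1, hc.2]

lemma Ctx.gen (h : Ctx F B ω αh) {x0 : E m} (hx : InC F ω x0) {s : Equiv.Perm (E m)}
    (hs : s ∈ SAff B αh) : ∃ γ n, GenData F x0 s γ n := by
  rcases hs with ⟨j, rfl⟩ | rfl
  · exact ⟨_, _, h.gen_simple hx j⟩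
  · exact ⟨_, _, h.gen_high hx⟩

lemma Ctx.S_sub (h : Ctx F B ω αh) {s : Equiv.Perm (E m)}
    (hs : s ∈ SAff B αh) : s ∈ Waff (F : Set (E m)) := by
  rcases hs with ⟨j, rfl⟩ | rfl
  · exact Subgroup.subset_closure ⟨_, h.memB j, _, rfl⟩
  · exact Subgroup.subset_closure ⟨_, h.neg h.hmem, _, rfl⟩

lemma S_inv {s : Equiv.Perm (E m)} (hs : s ∈ SAff B αh) : s⁻¹ = s := by
  rcases hs with ⟨j, rfl⟩ | rfl <;> exact affRefl_inv _ _

lemma S_sq {s : Equiv.Perm (E m)} (hs : s ∈ SAff B αh) : s * s = 1 := by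
  rcases hs with ⟨j, rfl⟩ | rfl <;> exact affRefl_mul_self _ _

lemma Ctx.list_sub (h : Ctx F B ω αh) {l : List (Equiv.Perm (E m))}
    (hl : ∀ s ∈ l, s ∈ SAff B αh) : l.prod ∈ Waff (F : Set (E m)) :=
  Subgroup.list_prod_mem _ fun s hs => h.S_sub (hl s hs)

/-- A regular point outside the base alcove is separated from it by a wall of the alcove. -/
lemma Ctx.exists_sep (h : Ctx F B ω αh) {y : E m} (hy : Reg F y) (hn : ¬ InC F ω y) :
    ∃ γ ∈ F, ∃ n : ℤ, affRefl γ n ∈ SAff B αh ∧ (n : ℝ) < ⟪γ, y⟫ ∧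
      ∀ x0, InC F ω x0 → ⟪γ, x0⟫ < n := by
  by_contra hcon
  push Not at hcon
  apply hn
  have hB : ∀ j, ⟪B j, y⟫ ≤ 0 := by
    intro j
    by_contra hj
    push Not at hj
    obtain ⟨x0, hx0, hlt⟩ := hcon (B j) (h.memB j) 0 (Or.inl ⟨j, rfl⟩) (by simpa using hj)
    exact absurd (h.gen_simple hx0 j).hi (not_lt.2 hlt)
  have hh : ⟪-αh, y⟫ < 1 := by
    refine lt_of_le_of_ne ?_ (by simpa using hy (-αh) (h.neg h.hmem) 1)
    by_contra hj
    push Not at hj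
    obtain ⟨x0, hx0, hlt⟩ := hcon (-αh) (h.neg h.hmem) 1 (Or.inr rfl) (by simpa using hj)
    exact absurd (h.gen_high hx0).hi (not_lt.2 hlt)
  rw [inner_neg_left] at hh
  intro α hα hp
  constructor
  · have : ⟪αh - α, y⟫ ≤ 0 := by
      rw [h.inner_expand]
      refine Finset.sum_nonpos fun j _ => mul_nonpos_of_nonneg_of_nonpos ?_ (hB j)
      rw [inner_sub_left]; linarith [h.high α hα j]
    rw [inner_sub_left] at this
    linarith
  · refine lt_of_le_of_ne ?_ (by simpa using hy α hα 0)
    rw [h.inner_expand]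
    exact Finset.sum_nonpos fun j _ => mul_nonpos_of_nonneg_of_nonpos (hp j) (hB j)

lemma Ctx.descent (h : Ctx F B ω αh) {x0 : E m} (hx0 : InC F ω x0) (n : ℕ) :
    ∀ y, Reg F y → D F x0 y ≤ n →
      ∃ l : List (Equiv.Perm (E m)), (∀ s ∈ l, s ∈ SAff B αh) ∧ InC F ω (l.prod y) := by
  induction n with
  | zero =>
    intro y hy hD
    by_cases hC : InC F ω y
    · exact ⟨[], by simp, by simpa using hC⟩
    exfalso
    obtain ⟨γ, hγ, n, hs, h1, h2⟩ := h.exists_sep hy hC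
    have := D_fold h.toSubRS hγ (h2 x0 hx0) h1
    have := D_nonneg F x0 (affRefl γ n y)
    push_cast at hD
    linarith
  | succ k ih =>
    intro y hy hD
    by_cases hC : InC F ω y
    · exact ⟨[], by simp, by simpa using hC⟩
    obtain ⟨γ, hγ, n, hs, h1, h2⟩ := h.exists_sep hy hC
    have hlt := D_fold h.toSubRS hγ (h2 x0 hx0) h1
    obtain ⟨l, hl, hlC⟩ := ih _ (Reg.map h.toSubRS (h.S_sub hs) hy)
      (by push_cast at hD; linarith)
    refine ⟨l ++ [affRefl γ n], ?_, ?_⟩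
    · intro s hs'
      rcases List.mem_append.1 hs' with h' | h'
      · exact hl s h'
      · rw [List.mem_singleton.1 h']; exact hs
    · simpa using hlC

lemma Ctx.exists_list_to_C (h : Ctx F B ω αh) {y : E m} (hy : Reg F y) :
    ∃ l : List (Equiv.Perm (E m)), (∀ s ∈ l, s ∈ SAff B αh) ∧ InC F ω (l.prod y) := by
  obtain ⟨x0, hx0⟩ := h.exists_InC
  exact h.descent hx0 (D F x0 y).toNat y hy (Int.self_le_toNat _)

/-- A gallery crossing a wall. -/
lemma Ctx.crossing (h : Ctx F B ω αh) {x0 : E m} (hx0 : InC F ω x0)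
    (l : List (Equiv.Perm (E m))) : (∀ s ∈ l, s ∈ SAff B αh) →
    ∀ (γ : E m) (n : ℤ), γ ∈ F → ⟪γ, x0⟫ < (n : ℝ) → (n : ℝ) < ⟪γ, l.prod x0⟫ →
      ∃ l1 t l2, l = l1 ++ t :: l2 ∧ affRefl γ n * l1.prod = l1.prod * t := by
  induction l with
  | nil =>
    intro _ γ n _ h1 h2
    simp at h2
    exact absurd h1 (not_lt.2 h2.le)
  | cons t l ih =>
    intro hl γ n hγ h1 h2
    have ht : t ∈ SAff B αh := hl t (by simp)
    have hl' : ∀ s ∈ l, s ∈ SAff B αh := fun s hs => hl s (by simp [hs])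
    obtain ⟨δ, k, hg⟩ := h.gen hx0 ht
    by_cases hc : (n : ℝ) < ⟪γ, t x0⟫
    · refine ⟨[], t, l, rfl, ?_⟩
      rw [List.prod_nil, mul_one, one_mul, hg.eq]
      have hfl : ⌊⟪γ, t x0⟫⌋ ≠ ⌊⟪γ, x0⟫⌋ := by
        have a1 : ⌊⟪γ, x0⟫⌋ < n := Int.floor_lt.2 h1
        have a2 : n ≤ ⌊⟪γ, t x0⟫⌋ := Int.le_floor.2 hc.le
        omega
      have hor : γ = δ ∨ γ = -δ := by
        by_contra hcon
        push Not at hcon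
        exact hfl (hg.other γ hγ hcon.1 hcon.2)
      have hval := inner_affRefl_self (h.ne δ hg.mem) k x0
      rw [← hg.eq] at hval
      have lo := hg.lo
      have hi := hg.hi
      rcases hor with rfl | rfl
      · have b1 : ((k - 1 : ℤ) : ℝ) < (n : ℝ) := by push_cast; linarith
        have b2 : (n : ℝ) < ((k + 1 : ℤ) : ℝ) := by push_cast; linarith
        have b1' := Int.cast_lt.1 b1
        have b2' := Int.cast_lt.1 b2
        rw [show n = k by omega]
      · exfalso
        rw [inner_neg_left] at h1 hc
        linarith
    · have htW := h.S_sub ht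
      obtain ⟨L, μ, hμ, -, hL1, hL2, hform⟩ := aff_form h.toSubRS htW
      obtain ⟨z, hz⟩ := Q_int h.toSubRS hμ γ hγ
      have hin : ∀ w, ⟪γ, t w⟫ = ⟪L.symm γ, w⟫ + z := by
        intro w
        rw [hform, inner_add_right, hz,
          ← LinearIsometryEquiv.inner_map_map L (L.symm γ) w, LinearIsometryEquiv.apply_symm_apply]
      have hreg : Reg F (t x0) := Reg.map h.toSubRS htW (h.reg_InC hx0)
      have hlt : ⟪γ, t x0⟫ < n := lt_of_le_of_ne (not_lt.1 hc) (hreg γ hγ n)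
      obtain ⟨l1, t', l2, hsplit, hcomm⟩ := ih hl' (L.symm γ) (n - z) (hL2 γ hγ)
        (by rw [hin] at hlt; push_cast; linarith)
        (by
          rw [List.prod_cons, Equiv.Perm.mul_apply, hin] at h2
          push_cast; linarith)
      refine ⟨t :: l1, t', l2, by rw [hsplit]; rfl, ?_⟩
      have hconj := conj_refl hform (L.symm γ) (n - z) n (by
        rw [LinearIsometryEquiv.apply_symm_apply, hz]; push_cast; ring)
      rw [LinearIsometryEquiv.apply_symm_apply] at hconj
      rw [List.prod_cons, ← mul_assoc, ← hconj, mul_assoc, hcomm, mul_assoc]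

lemma list_inv {l : List (Equiv.Perm (E m))}
    (hl : ∀ s ∈ l, s ∈ SAff B αh) : l.reverse.prod = l.prod⁻¹ := by
  rw [List.prod_inv_reverse]
  congr 2
  symm
  calc l.map (fun x => x⁻¹) = l.map id := List.map_congr_left fun s hs => S_inv (hl s hs)
    _ = l := by simp

lemma Ctx.refl_mem (h : Ctx F B ω αh) {x0 : E m} (hx0 : InC F ω x0) {α : E m} (hα : α ∈ F)
    {k : ℤ} (hk : ⟪α, x0⟫ < (k : ℝ)) : affRefl α k ∈ Subgroup.closure (SAff B αh) := by
  have hs : affRefl α k ∈ Waff (F : Set (E m)) := Subgroup.subset_closure ⟨α, hα, k, rfl⟩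
  have hreg := Reg.map h.toSubRS hs (h.reg_InC hx0)
  obtain ⟨l, hl, hC⟩ := h.exists_list_to_C hreg
  have hl' : ∀ s ∈ l.reverse, s ∈ SAff B αh := fun s hs => hl s (List.mem_reverse.1 hs)
  have hD : D F (l.reverse.prod x0) (affRefl α k x0) = 0 := by
    rw [← D_map h.toSubRS (h.list_sub hl), list_inv hl, ← Equiv.Perm.mul_apply l.prod, mul_inv_cancel, Equiv.Perm.one_apply]
    exact h.D_InC hx0 hC
  have hfl := D_eq_zero.1 hD α hα
  have hge : k ≤ ⌊⟪α, affRefl α k x0⟫⌋ := by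
    rw [Int.le_floor, inner_affRefl_self (h.ne α hα)]; linarith
  rw [← hfl, Int.le_floor] at hge
  have hgt := lt_of_le_of_ne hge
    (Ne.symm (Reg.map h.toSubRS (h.list_sub hl') (h.reg_InC hx0) α hα k))
  obtain ⟨l1, t, l2, hsplit, hcomm⟩ := h.crossing hx0 _ hl' α k hα hk hgt
  have hmem : ∀ s ∈ l1 ++ t :: l2, s ∈ SAff B αh := hsplit ▸ hl'
  have hl1 : l1.prod ∈ Subgroup.closure (SAff B αh) :=
    Subgroup.list_prod_mem _ fun s hs => Subgroup.subset_closure (hmem s (by simp [hs]))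
  have ht : t ∈ Subgroup.closure (SAff B αh) := Subgroup.subset_closure (hmem t (by simp))
  rw [eq_mul_inv_of_mul_eq hcomm]
  exact mul_mem (mul_mem hl1 ht) (inv_mem hl1)

lemma Ctx.Waff_le (h : Ctx F B ω αh) : Waff (F : Set (E m)) ≤ Subgroup.closure (SAff B αh) := by
  obtain ⟨x0, hx0⟩ := h.exists_InC
  unfold Waff
  rw [Subgroup.closure_le]
  rintro w ⟨α, hα, k, rfl⟩
  rcases lt_or_gt_of_ne (h.reg_InC hx0 α hα k) with h1 | h1
  · exact h.refl_mem hx0 hα h1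
  · rw [← affRefl_neg]
    refine h.refl_mem hx0 (h.neg hα) ?_
    rw [inner_neg_left]; push_cast; linarith

lemma Ctx.exists_list (h : Ctx F B ω αh) {w : Equiv.Perm (E m)} (hw : w ∈ Waff (F : Set (E m))) :
    ∃ l : List (Equiv.Perm (E m)), (∀ s ∈ l, s ∈ SAff B αh) ∧ l.prod = w := by
  have hw' : w ∈ (Subgroup.closure (SAff B αh)).toSubmonoid := h.Waff_le hw
  rw [Subgroup.closure_toSubmonoid] at hw'
  obtain ⟨l, hl, he⟩ := Submonoid.exists_list_of_mem_closure hw'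
  refine ⟨l, fun s hs => ?_, he⟩
  rcases hl s hs with h1 | h1
  · exact h1
  · have := S_inv (Set.mem_inv.1 h1)
    rw [inv_inv] at this
    rw [this]; exact Set.mem_inv.1 h1

lemma Ctx.D_gen (h : Ctx F B ω αh) {x0 : E m} {s : Equiv.Perm (E m)} {γ : E m} {n : ℤ}
    (hg : GenData F x0 s γ n) {y : E m} (hlt : ⟪γ, y⟫ < n) :
    D F (s x0) y = D F x0 y + 2 := by
  classical
  have hγ0 := h.ne γ hg.mem
  have hne : γ ≠ -γ := by
    intro hc
    have : (2 : ℝ) • γ = 0 := by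
      rw [two_smul]; nth_rewrite 2 [hc]; simp
    exact hγ0 ((smul_eq_zero.1 this).resolve_left two_ne_zero)
  have hval := inner_affRefl_self hγ0 n x0
  rw [← hg.eq] at hval
  have lo := hg.lo
  have hi := hg.hi
  have key : ∀ α ∈ F, |⌊⟪α, s x0⟫⌋ - ⌊⟪α, y⟫⌋| = |⌊⟪α, x0⟫⌋ - ⌊⟪α, y⟫⌋| +
      ((if α = γ then 1 else 0) + (if α = -γ then 1 else 0)) := by
    intro α hα
    by_cases h1 : α = γ
    · subst h1
      have e1 : ⌊⟪α, s x0⟫⌋ = n := by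
        rw [Int.floor_eq_iff, hval]; constructor <;> linarith
      have e2 : ⌊⟪α, x0⟫⌋ = n - 1 := by
        rw [Int.floor_eq_iff]; push_cast; constructor <;> linarith
      have e3 : ⌊⟪α, y⟫⌋ < n := Int.floor_lt.2 hlt
      rw [e1, e2, if_pos rfl, if_neg hne, abs_of_nonneg (by omega), abs_of_nonneg (by omega)]
      ring
    · by_cases h2 : α = -γ
      · subst h2
        have e1 : ⌊⟪-γ, s x0⟫⌋ = -n - 1 := by
          rw [Int.floor_eq_iff, inner_neg_left, hval]; push_cast; constructor <;> linarith
        have e2 : ⌊⟪-γ, x0⟫⌋ = -n := by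
          rw [Int.floor_eq_iff, inner_neg_left]; push_cast; constructor <;> linarith
        have e3 : -n ≤ ⌊⟪-γ, y⟫⌋ := by
          rw [Int.le_floor, inner_neg_left]; push_cast; linarith
        rw [e1, e2, if_pos rfl, if_neg hne.symm, abs_of_nonpos (by omega), abs_of_nonpos (by omega)]
        ring
      · rw [hg.other α hα h1 h2, if_neg h1, if_neg h2]; simp
  unfold D
  rw [Finset.sum_congr rfl key, Finset.sum_add_distrib, Finset.sum_add_distrib,
    Finset.sum_ite_eq', Finset.sum_ite_eq', if_pos hg.mem, if_pos (h.neg hg.mem)]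
  rfl

lemma Ctx.minimal_list (h : Ctx F B ω αh) {x0 : E m} (hx0 : InC F ω x0)
    (l : List (Equiv.Perm (E m))) : (∀ s ∈ l, s ∈ SAff B αh) →
    (∀ l' : List (Equiv.Perm (E m)), (∀ s ∈ l', s ∈ SAff B αh) → l'.prod = l.prod →
      l.length ≤ l'.length) → D F x0 (l.prod x0) = 2 * l.length := by
  induction l with
  | nil => intro _ _; simpa using D_eq_zero.2 fun _ _ => rfl
  | cons s l ih =>
    intro hl hmin
    have hs : s ∈ SAff B αh := hl s (by simp)
    have hl' : ∀ s ∈ l, s ∈ SAff B αh := fun s hs => hl s (by simp [hs])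
    have hIH := ih hl' (by
      intro l' hl'S he
      have := hmin (s :: l') (by
        intro t ht
        rcases List.mem_cons.1 ht with rfl | ht
        · exact hs
        · exact hl'S t ht) (by rw [List.prod_cons, he, List.prod_cons])
      simpa using this)
    obtain ⟨γ, n, hg⟩ := h.gen hx0 hs
    have hreg : Reg F (l.prod x0) := Reg.map h.toSubRS (h.list_sub hl') (h.reg_InC hx0)
    have hlt : ⟪γ, l.prod x0⟫ < n := by
      refine lt_of_le_of_ne ?_ (hreg γ hg.mem n)
      by_contra hcon
      push Not at hcon
      obtain ⟨l1, t, l2, hsplit, hcomm⟩ := h.crossing hx0 l hl' γ n hg.mem hg.hi hcon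
      subst hsplit
      have ht : t ∈ SAff B αh := hl' t (by simp)
      have := hmin (l1 ++ l2) (by
        intro t' ht'
        refine hl' t' ?_
        rcases List.mem_append.1 ht' with h1 | h1 <;> simp [h1]) (by
        rw [List.prod_cons, List.prod_append, List.prod_append, List.prod_cons, ← mul_assoc s,
          hg.eq, hcomm, mul_assoc, ← mul_assoc t, S_sq ht, one_mul])
      simp at this
    have e : D F x0 ((s :: l).prod x0) = D F (s x0) (l.prod x0) := by
      rw [← D_map h.toSubRS (h.S_sub hs) (s x0), List.prod_cons, Equiv.Perm.mul_apply,
        ← Equiv.Perm.mul_apply s s, S_sq hs, Equiv.Perm.one_apply]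
    rw [e, h.D_gen hg hlt, hIH]
    simp; ring

/-- Word length equals the number of separating walls. -/
lemma Ctx.len_eq (h : Ctx F B ω αh) {x0 : E m} (hx0 : InC F ω x0) {w : Equiv.Perm (E m)}
    (hw : w ∈ Waff (F : Set (E m))) : D F x0 (w x0) = 2 * (len (SAff B αh) w : ℤ) := by
  have hne : {k | ∃ l : List (Equiv.Perm (E m)), (∀ g ∈ l, g ∈ SAff B αh) ∧ l.length = k ∧
      l.prod = w}.Nonempty := by
    obtain ⟨l, hl, he⟩ := h.exists_list hw
    exact ⟨l.length, l, hl, rfl, he⟩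
  obtain ⟨l, hl, hlen, he⟩ := Nat.sInf_mem hne
  have := h.minimal_list hx0 l hl (by
    intro l' hl' he'
    rw [hlen]
    exact Nat.sInf_le ⟨l', hl', rfl, he'.trans he⟩)
  rw [he, hlen] at this
  exact this

/-- Coroots pair with the fundamental coweight in multiples of the simple coroot pairing. -/
lemma Ctx.coroot_coeff (h : Ctx F B ω αh) (i : Fin m) (n : ℕ) :
    ∀ α ∈ F, Pos ω α → ∑ j, ⟪α, ω j⟫ ≤ n →
      ∃ z : ℤ, ⟪coroot α, ω i⟫ = z * ⟪coroot (B i), ω i⟫ := by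
  induction n with
  | zero =>
    intro α hα hp hle
    exfalso
    obtain ⟨j, hj⟩ := h.exists_pos_coeff hα hp
    have := Finset.sum_pos' (fun k _ => hp k) ⟨j, Finset.mem_univ _, hj⟩
    push_cast at hle
    linarith
  | succ n ih =>
    intro α hα hp hle
    have hex : ∃ j, 0 < ⟪B j, α⟫ := by
      by_contra hcon
      push Not at hcon
      have h1 : ⟪α, α⟫ ≤ 0 := by
        rw [h.inner_expand α α]
        exact Finset.sum_nonpos fun j _ => mul_nonpos_of_nonneg_of_nonpos (hp j) (hcon j)
      exact absurd (real_inner_self_pos.2 (h.ne α hα)) (not_lt.2 h1)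
    obtain ⟨j, hj⟩ := hex
    by_cases hαj : α = B j
    · subst hαj
      by_cases hji : j = i
      · subst hji; exact ⟨1, by simp⟩
      · refine ⟨0, ?_⟩
        rw [coroot, real_inner_smul_left, h.dual, if_neg hji]; simp
    have hBB : 0 < ⟪B j, B j⟫ := real_inner_self_pos.2 (h.ne _ (h.memB j))
    obtain ⟨z, hz⟩ := h.cryst α hα (B j) (h.memB j)
    have hz' : (z : ℝ) = 2 / ⟪B j, B j⟫ * ⟪B j, α⟫ := by
      rw [← hz, coroot, real_inner_smul_right, real_inner_comm α]
    have hz1 : (1 : ℝ) ≤ z := by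
      have : (0 : ℝ) < z := by rw [hz']; positivity
      exact_mod_cast this
    have hr : linRefl (B j) α = α - (z : ℝ) • B j := by
      rw [linRefl_apply, coroot, smul_smul, hz', mul_comm]
    have hsum : ∑ k, ⟪linRefl (B j) α, ω k⟫ = ∑ k, ⟪α, ω k⟫ - z := by
      rw [hr]
      simp [inner_sub_left, real_inner_smul_left, h.dual, Finset.sum_sub_distrib]
    obtain ⟨y, hy⟩ := ih _ (h.refl _ (h.memB j) _ hα) (h.simple_refl_pos hα hp hαj)
      (by rw [hsum]; push_cast at hle; linarith)
    rw [coroot_map, linRefl_apply, inner_sub_left, real_inner_smul_left] at hy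
    obtain ⟨x, hx⟩ := h.cryst (B j) (h.memB j) α hα
    rw [hx] at hy
    by_cases hji : j = i
    · subst hji
      exact ⟨y + x, by push_cast; linarith⟩
    · refine ⟨y, ?_⟩
      rw [show ⟪coroot (B j), ω i⟫ = (0 : ℝ) by
        rw [coroot, real_inner_smul_left, h.dual, if_neg hji, mul_zero]] at hy
      linarith

lemma Ctx.Q_coeff (h : Ctx F B ω αh) (i : Fin m) {μ : E m} (hμ : μ ∈ Q F) :
    ∃ z : ℤ, ⟪μ, ω i⟫ = z * ⟪coroot (B i), ω i⟫ := by
  unfold Q at hμ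
  induction hμ using AddSubgroup.closure_induction with
  | mem x hx =>
    obtain ⟨α, hα, rfl⟩ := hx
    rcases h.pos_or_neg hα with hp | hp
    · exact h.coroot_coeff i ⌈∑ j, ⟪α, ω j⟫⌉₊ α hα hp (Nat.le_ceil _)
    · obtain ⟨z, hz⟩ := h.coroot_coeff i ⌈∑ j, ⟪-α, ω j⟫⌉₊ (-α) (h.neg hα) hp (Nat.le_ceil _)
      rw [coroot_neg, inner_neg_left] at hz
      exact ⟨-z, by push_cast; linarith⟩
  | zero => exact ⟨0, by simp⟩
  | add x y _ _ hx hy =>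
    obtain ⟨a, ha⟩ := hx
    obtain ⟨b, hb⟩ := hy
    exact ⟨a + b, by rw [inner_add_left, ha, hb]; push_cast; ring⟩
  | neg x _ hx =>
    obtain ⟨a, ha⟩ := hx
    exact ⟨-a, by rw [inner_neg_left, ha]; push_cast; ring⟩

end Tube

namespace Tube

variable {F : Finset (E m)} {B ω : Fin m → E m} {αh : E m}

lemma fin_order (h : Ctx F B ω αh) (L : E m ≃ₗᵢ[ℝ] E m) (hL : ∀ α ∈ F, L α ∈ F) :
    ∃ N : ℕ, 0 < N ∧ ∀ x, L^[N] x = x := by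
  have hit : ∀ k : ℕ, ∀ α ∈ F, L^[k] α ∈ F := by
    intro k
    induction k with
    | zero => intro α hα; exact hα
    | succ k ih => intro α hα; rw [Function.iterate_succ_apply']; exact hL _ (ih α hα)
  obtain ⟨a, b, hab, he⟩ := Finite.exists_ne_map_eq_of_infinite
    (fun k : ℕ => fun α : F => (⟨L^[k] α, hit k α α.2⟩ : F))
  have key : ∀ a b : ℕ, a < b → (∀ α ∈ F, L^[a] α = L^[b] α) →
      ∃ N : ℕ, 0 < N ∧ ∀ x, L^[N] x = x := by
    intro a b hab he
    refine ⟨b - a, by omega, ?_⟩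
    have hfix : ∀ α ∈ F, L^[b - a] α = α := by
      intro α hα
      have h1 := he α hα
      rw [show b = a + (b - a) by omega, Function.iterate_add_apply] at h1
      exact ((L.injective.iterate a) h1).symm
    have hlin : ∀ k : ℕ, ∀ x, L^[k] x = (L.toLinearEquiv.toLinearMap ^ k) x := by
      intro k x
      rw [Module.End.pow_apply]; rfl
    intro x
    rw [hlin]
    conv_lhs => rw [h.expand x]
    conv_rhs => rw [h.expand x]
    rw [map_sum]
    refine Finset.sum_congr rfl fun j _ => ?_
    rw [map_smul, ← hlin, hfix _ (h.memB j)]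
  have he' : ∀ α ∈ F, L^[a] α = L^[b] α := by
    intro α hα
    have := congrFun he ⟨α, hα⟩
    simpa using this
  rcases lt_or_gt_of_ne hab with h1 | h1
  · exact key a b h1 he'
  · exact key b a h1 fun α hα => (he' α hα).symm

/-- The subsystem of roots orthogonal to a vector. -/
def sub (F : Finset (E m)) (v : E m) : Finset (E m) := by
  classical exact F.filter fun α => ⟪α, v⟫ = (0 : ℝ)

lemma mem_sub {v α : E m} : α ∈ sub F v ↔ α ∈ F ∧ ⟪α, v⟫ = (0 : ℝ) := by
  simp [sub]

lemma SubRS.sub (h : SubRS F) (v : E m) : SubRS (sub F v) where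
  ne := fun α hα => h.ne α (mem_sub.1 hα).1
  refl := fun α hα β hβ => by
    rw [mem_sub] at *
    refine ⟨h.refl α hα.1 β hβ.1, ?_⟩
    rw [linRefl_apply, inner_sub_left, hβ.2, real_inner_smul_left, coroot, real_inner_smul_left,
      hα.2]
    simp
  cryst := fun α hα β hβ => h.cryst α (mem_sub.1 hα).1 β (mem_sub.1 hβ).1

lemma Waff_sub_le (v : E m) : Waff (sub F v : Set (E m)) ≤ Waff (F : Set (E m)) := by
  refine Subgroup.closure_mono ?_
  rintro w ⟨α, hα, k, rfl⟩
  exact ⟨α, (mem_sub.1 hα).1, k, rfl⟩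

lemma Waff_sub_inner (v : E m) {a : Equiv.Perm (E m)} (ha : a ∈ Waff (sub F v : Set (E m))) :
    ∀ x, ⟪a x, v⟫ = ⟪x, v⟫ := by
  unfold Waff at ha
  induction ha using Subgroup.closure_induction with
  | mem w hw =>
    obtain ⟨α, hα, k, rfl⟩ := hw
    intro x
    rw [affRefl_apply, inner_sub_left, real_inner_smul_left, coroot, real_inner_smul_left,
      (mem_sub.1 hα).2]
    simp
  | one => intro x; rfl
  | mul a b _ _ ha hb => intro x; rw [Equiv.Perm.mul_apply, ha, hb]
  | inv a _ ha =>
    intro x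
    rw [← ha, ← Equiv.Perm.mul_apply, mul_inv_cancel, Equiv.Perm.one_apply]

lemma trans_mem {α : E m} (hα : α ∈ F) (h0 : α ≠ 0) :
    ∃ t ∈ Waff (F : Set (E m)), ∀ x, t x = x + coroot α := by
  refine ⟨affRefl α 1 * affRefl α 0, mul_mem (Subgroup.subset_closure ⟨α, hα, 1, rfl⟩)
    (Subgroup.subset_closure ⟨α, hα, 0, rfl⟩), fun x => ?_⟩
  rw [Equiv.Perm.mul_apply, affRefl_apply, inner_affRefl_self h0, affRefl_apply]
  push_cast
  module

lemma fix_of_inner {L : E m ≃ₗᵢ[ℝ] E m} {v : E m} (hL : ∀ x, ⟪L x, v⟫ = ⟪x, v⟫) : L v = v := by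
  refine ext_inner_left ℝ fun x => ?_
  have h1 := hL (L.symm x)
  have h2 := LinearIsometryEquiv.inner_map_map L (L.symm x) v
  rw [LinearIsometryEquiv.apply_symm_apply] at h1 h2
  rw [h1, h2]

lemma Ctx.axis (h : Ctx F B ω αh) (i : Fin m) :
    ∃ w0 ∈ Waff (F : Set (E m)), ∃ p, Reg F p ∧
      w0 p = p + (⟪ω i, coroot (B i)⟫ / ⟪ω i, ω i⟫) • ω i ∧
      ∀ x (t : ℝ), w0 (x + t • ω i) = w0 x + t • ω i := by
  set v := ω i with hv
  set c : ℝ := ⟪v, coroot (B i)⟫ / ⟪v, v⟫ with hc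
  have hS : SubRS (sub F v) := h.toSubRS.sub v
  have hv0 : v ≠ 0 := by
    intro h0
    have := h.dual i i
    rw [← hv, h0] at this
    simp at this
  have hvv : ⟪v, v⟫ ≠ (0 : ℝ) := (inner_self_ne_zero (𝕜 := ℝ)).mpr hv0
  have hcv : c * ⟪v, v⟫ = ⟪v, coroot (B i)⟫ := div_mul_cancel₀ _ hvv
  obtain ⟨y0, hy0C⟩ := h.exists_InC
  have hy0 : Reg (sub F v) y0 := fun α hα k => h.reg_InC hy0C α (mem_sub.1 hα).1 k
  obtain ⟨t, htW, ht⟩ := trans_mem (h.memB i) (h.ne _ (h.memB i))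
  have htint : ∀ α ∈ sub F v, ∃ z : ℤ, ∀ x, ⟪α, t x⟫ = ⟪α, x⟫ + z := by
    intro α hα
    obtain ⟨z, hz⟩ := h.cryst α (mem_sub.1 hα).1 _ (h.memB i)
    exact ⟨z, fun x => by rw [ht, inner_add_right, hz]⟩
  have htReg : Reg (sub F v) (t y0) := by
    intro α hα k hk
    obtain ⟨z, hz⟩ := htint α hα
    rw [hz] at hk
    exact hy0 α hα (k - z) (by push_cast; linarith)
  have htD : ∀ x y, D (sub F v) (t x) (t y) = D (sub F v) x y := by
    intro x y
    unfold D
    refine Finset.sum_congr rfl fun α hα => ?_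
    obtain ⟨z, hz⟩ := htint α hα
    rw [hz, hz, Int.floor_add_intCast, Int.floor_add_intCast]
    congr 1; ring
  obtain ⟨a, haW, haD⟩ := exists_to_alcove hS hy0 (D (sub F v) y0 (t y0)).toNat (t y0) htReg
    (Int.self_le_toNat _)
  set w := a * t with hw
  have hwW : w ∈ Waff (F : Set (E m)) := mul_mem (Waff_sub_le v haW) htW
  obtain ⟨L, μ, hμ, -, hL1, hL2, hform⟩ := aff_form h.toSubRS hwW
  have hinner : ∀ x, ⟪w x, v⟫ = ⟪x, v⟫ + ⟪v, coroot (B i)⟫ := by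
    intro x
    rw [hw, Equiv.Perm.mul_apply, Waff_sub_inner v haW, ht, inner_add_left,
      real_inner_comm v (coroot (B i))]
  have hLinner : ∀ x, ⟪L x, v⟫ = ⟪x, v⟫ := by
    intro x
    have h1 := hinner x
    have h2 := hinner 0
    rw [hform, inner_add_left] at h1 h2
    rw [map_zero, inner_zero_left] at h2
    linarith
  have hLv : L v = v := fix_of_inner hLinner
  have hpar : ∀ x (s : ℝ), w (x + s • v) = w x + s • v := by
    intro x s
    rw [hform, hform, map_add, map_smul, hLv]
    module
  have hwD : ∀ x, D (sub F v) y0 x = 0 → D (sub F v) y0 (w x) = 0 := by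
    intro x hx
    refine le_antisymm ?_ (D_nonneg _ _ _)
    have h1 := D_tri (sub F v) y0 (a (t y0)) (w x)
    have h2 : D (sub F v) (a (t y0)) (w x) = 0 := by
      rw [hw, Equiv.Perm.mul_apply, D_map hS haW, htD, hx]
    linarith
  have hyD : ∀ k : ℕ, D (sub F v) y0 (w^[k] y0) = 0 := by
    intro k
    induction k with
    | zero => exact D_eq_zero.2 fun _ _ => rfl
    | succ k ih => rw [Function.iterate_succ_apply']; exact hwD _ ih
  obtain ⟨N, hN, hLN⟩ := fin_order h L hL1
  have hdiff : ∀ k : ℕ, ∀ x y, w^[k] x - w^[k] y = L^[k] (x - y) := by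
    intro k
    induction k with
    | zero => intro x y; rfl
    | succ k ih =>
      intro x y
      rw [Function.iterate_succ_apply', Function.iterate_succ_apply', Function.iterate_succ_apply',
        ← ih, hform, hform, map_sub]
      abel
  set ν := w^[N] y0 - y0 with hν
  have hwN : ∀ x, w^[N] x = x + ν := by
    intro x
    have h1 := hdiff N x y0
    rw [hLN] at h1
    rw [hν, eq_add_of_sub_eq h1]
    abel
  have hwNk : ∀ k : ℕ, w^[N * k] y0 = y0 + (k : ℝ) • ν := by
    intro k
    induction k with
    | zero => simp
    | succ k ih =>
      rw [Nat.mul_succ, Nat.add_comm, Function.iterate_add_apply, ih, hwN]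
      push_cast
      module
  have hνort : ∀ α ∈ sub F v, ⟪α, ν⟫ = (0 : ℝ) := by
    intro α hα
    by_contra hne
    obtain ⟨k, hk⟩ := exists_nat_gt (1 / |⟪α, ν⟫|)
    rw [div_lt_iff₀ (abs_pos.2 hne)] at hk
    have hfl := D_eq_zero.1 (hyD (N * k)) α hα
    rw [hwNk, inner_add_right, real_inner_smul_right] at hfl
    have h1 := Int.abs_sub_lt_one_of_floor_eq_floor hfl
    rw [sub_add_cancel_left, abs_neg, abs_mul, Nat.abs_cast] at h1
    linarith
  have hνv : ∀ k : ℕ, ⟪w^[k] y0, v⟫ = ⟪y0, v⟫ + k * ⟪v, coroot (B i)⟫ := by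
    intro k
    induction k with
    | zero => simp
    | succ k ih =>
      rw [Function.iterate_succ_apply', hinner, ih]; push_cast; ring
  have hνeq : ν = ((N : ℝ) * c) • v := by
    rw [← sub_eq_zero, ← inner_self_eq_zero (𝕜 := ℝ), h.inner_expand]
    refine Finset.sum_eq_zero fun j _ => ?_
    by_cases hj : j = i
    · subst hj
      rw [← hv, inner_sub_left, hν, inner_sub_left, hνv, real_inner_smul_left, mul_assoc, hcv]
      ring
    · have hBj : ⟪B j, v⟫ = (0 : ℝ) := by rw [hv, h.dual, if_neg hj]
      rw [inner_sub_right, real_inner_smul_right, hBj,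
        hνort _ (mem_sub.2 ⟨h.memB j, hBj⟩)]
      ring
  have hN' : (N : ℝ) ≠ 0 := by exact_mod_cast hN.ne'
  set p' : E m := (N : ℝ)⁻¹ • ∑ k ∈ Finset.range N, w^[k] y0 with hp'
  have hwp' : w p' = p' + c • v := by
    have e1 : ∀ k : ℕ, L (w^[k] y0) = w^[k+1] y0 - μ := by
      intro k
      rw [Function.iterate_succ_apply', hform]; abel
    have e2 : ∑ k ∈ Finset.range N, w^[k+1] y0 = ∑ k ∈ Finset.range N, w^[k] y0 + ν := by
      have := Finset.sum_range_sub (fun k => w^[k] y0) N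
      rw [Finset.sum_sub_distrib] at this
      rw [hν, eq_add_of_sub_eq this]
      simp [add_comm]
    rw [hform, hp', map_smul, map_sum, Finset.sum_congr rfl fun k _ => e1 k,
      Finset.sum_sub_distrib, e2, Finset.sum_const, Finset.card_range, hνeq,
      ← Nat.cast_smul_eq_nsmul ℝ, smul_sub, smul_add, smul_smul, smul_smul, ← mul_assoc,
      inv_mul_cancel₀ hN']
    module
  have hp'Reg : Reg (sub F v) p' := by
    refine Reg.of_D hS hy0 (D_eq_zero.2 fun α hα => ?_)
    symm
    rw [Int.floor_eq_iff]
    have hb : ∀ k : ℕ, (⌊⟪α, y0⟫⌋ : ℝ) ≤ ⟪α, w^[k] y0⟫ ∧ ⟪α, w^[k] y0⟫ < ⌊⟪α, y0⟫⌋ + 1 :=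
      fun k => Int.floor_eq_iff.1 (D_eq_zero.1 (hyD k) α hα).symm
    have hpos : (0 : ℝ) < N := by exact_mod_cast hN
    rw [hp', real_inner_smul_right, inner_sum, inv_mul_eq_div]
    constructor
    · rw [le_div_iff₀ hpos]
      have := Finset.sum_le_sum (s := Finset.range N) fun k _ => (hb k).1
      simp only [Finset.sum_const, Finset.card_range, nsmul_eq_mul] at this
      linarith
    · rw [div_lt_iff₀ hpos]
      have := Finset.sum_lt_sum_of_nonempty (s := Finset.range N)
        (Finset.nonempty_range_iff.2 hN.ne') fun k _ => (hb k).2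
      simp only [Finset.sum_const, Finset.card_range, nsmul_eq_mul] at this
      linarith
  -- a generic point of the axis
  have hcount : (⋃ α ∈ F, Set.range fun k : ℤ => ((k : ℝ) - ⟪α, p'⟫) / ⟪α, v⟫).Countable :=
    Set.Countable.biUnion (Finset.countable_toSet F) fun α _ => Set.countable_range _
  obtain ⟨s, hs⟩ : ∃ s : ℝ, s ∉ ⋃ α ∈ F, Set.range fun k : ℤ => ((k : ℝ) - ⟪α, p'⟫) / ⟪α, v⟫ := by
    by_contra hcon
    push Not at hcon
    exact Set.not_countable_univ (hcount.mono fun s _ => hcon s)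
  refine ⟨w, hwW, p' + s • v, ?_, ?_, hpar⟩
  · intro α hα k hk
    rw [inner_add_right, real_inner_smul_right α v s] at hk
    by_cases h0 : ⟪α, v⟫ = (0 : ℝ)
    · rw [h0, mul_zero, add_zero] at hk
      exact hp'Reg α (mem_sub.2 ⟨hα, h0⟩) k hk
    · apply hs
      simp only [Set.mem_iUnion, Set.mem_range]
      refine ⟨α, hα, k, ?_⟩
      rw [div_eq_iff h0]; linarith
  · rw [hpar, hwp']; abel

/-! ## Hyperbolic geometry -/

lemma hyp_of_axis {w : Equiv.Perm (E m)} {L : E m ≃ₗᵢ[ℝ] E m} {μ β x0 : E m} {c : ℝ}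
    (hform : ∀ x, w x = L x + μ) (hLβ : L β = β) (hx0 : w x0 = x0 + c • β) (hc : 0 < c)
    (hβ : β ≠ 0) : IsHyperbolic (w : E m → E m) ∧ HasTransVec (w : E m → E m) (c • β) := by
  have hββ : 0 < ⟪β, β⟫ := real_inner_self_pos.2 hβ
  have hin : ∀ x, ⟪w x - x, β⟫ = c * ⟪β, β⟫ := by
    have h1 : ∀ x, ⟪w x - x, β⟫ = ⟪μ, β⟫ := by
      intro x
      have : ⟪L x, β⟫ = ⟪x, β⟫ := by
        conv_lhs => rw [← hLβ]
        exact LinearIsometryEquiv.inner_map_map L x β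
      rw [hform, inner_sub_left, inner_add_left, this]; ring
    intro x
    rw [h1 x, ← h1 x0, hx0, add_sub_cancel_left, real_inner_smul_left]
  have hn : ‖β‖ * ‖β‖ = ⟪β, β⟫ := (real_inner_self_eq_norm_mul_norm β).symm
  have hnp : 0 < ‖β‖ := norm_pos_iff.2 hβ
  have hd : ∀ x, dist x (w x) = ‖w x - x‖ := fun x => by rw [dist_comm, dist_eq_norm]
  have hlow : ∀ x, c * ‖β‖ ≤ dist x (w x) := by
    intro x
    have h1 := real_inner_le_norm (w x - x) β
    rw [hin, ← hn, ← hd, ← mul_assoc] at h1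
    exact le_of_mul_le_mul_right h1 hnp
  have hat : dist x0 (w x0) = c * ‖β‖ := by
    rw [hd, hx0, add_sub_cancel_left, norm_smul, Real.norm_of_nonneg hc.le]
  have hmin : minDisp (w : E m → E m) = c * ‖β‖ := by
    refine le_antisymm ?_ (le_ciInf hlow)
    rw [← hat]
    exact ciInf_le ⟨0, by rintro _ ⟨x, rfl⟩; exact dist_nonneg⟩ x0
  refine ⟨⟨⟨x0, hat.trans hmin.symm⟩, by rw [hmin]; positivity⟩, ?_⟩
  intro x hx
  have hx' : ‖w x - x‖ = c * ‖β‖ := by rw [← hd]; exact hx.trans hmin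
  have h0 : ⟪w x - x - c • β, w x - x - c • β⟫ = (0 : ℝ) := by
    rw [real_inner_sub_sub_self, real_inner_smul_right, hin, real_inner_smul_left,
      real_inner_smul_right, real_inner_self_eq_norm_mul_norm, hx', ← hn]
    ring
  have h1 := (inner_self_eq_zero (𝕜 := ℝ)).1 h0
  rw [sub_sub, sub_eq_zero] at h1
  exact h1

lemma fix_of_trans {w : Equiv.Perm (E m)} {L : E m ≃ₗᵢ[ℝ] E m} {μ β x : E m} {c : ℝ}
    (hform : ∀ x, w x = L x + μ) (hc : 0 < c)
    (hx : x ∈ minSet (w : E m → E m)) (hxβ : w x = x + c • β) : L β = β := by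
  have hmin : ∀ y, ‖c • β‖ ≤ ‖w y - y‖ := by
    intro y
    have h1 : minDisp (w : E m → E m) ≤ dist y (w y) :=
      ciInf_le ⟨0, by rintro _ ⟨x, rfl⟩; exact dist_nonneg⟩ y
    rw [← (show dist x (w x) = minDisp (w : E m → E m) from hx), dist_comm, dist_comm y,
      dist_eq_norm, dist_eq_norm, hxβ, add_sub_cancel_left] at h1
    exact h1
  refine fix_of_inner fun z => ?_
  set d := L z - z with hd
  have hq : ∀ t : ℝ, 0 ≤ 2 * t * (c * ⟪d, β⟫) + t ^ 2 * ⟪d, d⟫ := by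
    intro t
    have h1 := hmin (x + t • z)
    have h2 : w (x + t • z) - (x + t • z) = c • β + t • d := by
      have h3 : L x = x + c • β - μ := by rw [← hxβ, hform]; abel
      rw [hform, map_add, map_smul, h3, hd]
      module
    rw [h2] at h1
    have h4 := mul_self_le_mul_self (norm_nonneg _) h1
    rw [← real_inner_self_eq_norm_mul_norm, ← real_inner_self_eq_norm_mul_norm,
      real_inner_add_add_self, real_inner_smul_left β (t • d) c, real_inner_smul_right β d t,
      real_inner_smul_left d (t • d) t, real_inner_smul_right d d t, real_inner_comm d β] at h4
    nlinarith
  have hdd : 0 ≤ ⟪d, d⟫ := real_inner_self_nonneg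
  have hz : c * ⟪d, β⟫ = 0 := by
    set a := c * ⟪d, β⟫
    set b := ⟪d, d⟫
    have h1 := hq (-a / (b + 1))
    have hb : 0 < b + 1 := by linarith
    have h2 : 2 * (-a / (b + 1)) * a + (-a / (b + 1)) ^ 2 * b = -(a ^ 2 * (b + 2)) / (b + 1) ^ 2 := by
      field_simp; ring
    rw [h2, le_div_iff₀ (by positivity)] at h1
    have h3 : a ^ 2 ≤ 0 := by nlinarith [sq_nonneg a]
    exact pow_eq_zero_iff two_ne_zero |>.1 (le_antisymm h3 (sq_nonneg a))
  have h5 : ⟪d, β⟫ = (0 : ℝ) := (mul_eq_zero.1 hz).resolve_left hc.ne'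
  rw [hd, inner_sub_left] at h5
  linarith

lemma Ctx.min_trans (h : Ctx F B ω αh) (i : Fin m) {K : E m ≃ₗᵢ[ℝ] E m}
    (hK : ∀ α ∈ F, K.symm α ∈ F) {w : Equiv.Perm (E m)} (hw : w ∈ Waff (F : Set (E m)))
    (hyp : IsHyperbolic (w : E m → E m)) {c : ℝ} (ht : HasTransVec (w : E m → E m) (c • K (ω i)))
    (hc : 0 < c) : ⟪ω i, coroot (B i)⟫ / ⟪ω i, ω i⟫ ≤ c := by
  obtain ⟨L, μ, hμ, -, hL1, hL2, hform⟩ := aff_form h.toSubRS hw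
  obtain ⟨x, hx⟩ := hyp.1
  have hxβ := ht x hx
  have hLβ := fix_of_trans hform hc hx hxβ
  have hω0 : ω i ≠ 0 := by
    intro h0
    have := h.dual i i
    rw [h0] at this
    simp at this
  have hωω : 0 < ⟪ω i, ω i⟫ := real_inner_self_pos.2 hω0
  obtain ⟨z, hz⟩ := h.Q_coeff i (Q_map K.symm hK hμ)
  have h1 : c * ⟪ω i, ω i⟫ = ⟪K.symm μ, ω i⟫ := by
    have e1 : ⟪w x - x, K (ω i)⟫ = ⟪μ, K (ω i)⟫ := by
      have : ⟪L x, K (ω i)⟫ = ⟪x, K (ω i)⟫ := by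
        conv_lhs => rw [← hLβ]
        exact LinearIsometryEquiv.inner_map_map L _ _
      rw [hform, inner_sub_left, inner_add_left, this]; ring
    rw [hxβ, add_sub_cancel_left, real_inner_smul_left, LinearIsometryEquiv.inner_map_map] at e1
    rw [e1, ← LinearIsometryEquiv.inner_map_map K (K.symm μ), LinearIsometryEquiv.apply_symm_apply]
  have hpos : 0 < ⟪coroot (B i), ω i⟫ := by
    rw [coroot, real_inner_smul_left, h.dual, if_pos rfl, mul_one]
    exact div_pos two_pos (real_inner_self_pos.2 (h.ne _ (h.memB i)))
  have hzpos : 0 < z := by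
    have : 0 < (z : ℝ) * ⟪coroot (B i), ω i⟫ := by rw [← hz, ← h1]; positivity
    exact_mod_cast (mul_pos_iff_of_pos_right hpos).1 this
  have hz1 : (1 : ℝ) ≤ z := by exact_mod_cast hzpos
  rw [div_le_iff₀ hωω, h1, hz, real_inner_comm]
  nlinarith

/-! ## Tubes -/

lemma tube_compl_map (h : SubRS F) {v : E m} {w : Equiv.Perm (E m)}
    (hw : w ∈ Waff (F : Set (E m))) (hpar : ∀ x (t : ℝ), w (x + t • v) = w x + t • v) {x : E m}
    (hx : x ∈ (tubeWalls (F : Set (E m)) v)ᶜ) : w x ∈ (tubeWalls (F : Set (E m)) v)ᶜ := by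
  obtain ⟨L, μ, hμ, -, hL1, hL2, hform⟩ := aff_form h hw
  have hLv : L v = v := by
    have := hpar 0 1
    rw [hform, hform] at this
    simp only [one_smul, zero_add, map_zero] at this
    rw [add_comm μ] at this
    exact add_right_cancel this
  intro hwx
  apply hx
  simp only [tubeWalls, Set.mem_iUnion] at hwx ⊢
  obtain ⟨α, ⟨hα, hαv⟩, k, hk⟩ := hwx
  obtain ⟨z, hz⟩ := Q_int h hμ α hα
  refine ⟨L.symm α, ⟨hL2 α hα, ?_⟩, k - z, ?_⟩
  · rw [← LinearIsometryEquiv.inner_map_map L, LinearIsometryEquiv.apply_symm_apply, hLv, hαv]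
  · have hk' : ⟪α, w x⟫ = (k : ℝ) := hk
    rw [hform, inner_add_right, hz] at hk'
    show ⟪L.symm α, x⟫ = ((k - z : ℤ) : ℝ)
    rw [← LinearIsometryEquiv.inner_map_map L, LinearIsometryEquiv.apply_symm_apply]
    push_cast; linarith

lemma tube_image (h : SubRS F) {v : E m} {w : Equiv.Perm (E m)}
    (hw : w ∈ Waff (F : Set (E m))) (hpar : ∀ x (t : ℝ), w (x + t • v) = w x + t • v) {x : E m}
    (hx : x ∈ (tubeWalls (F : Set (E m)) v)ᶜ) {c : ℝ} (hwx : w x = x + c • v) :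
    w '' (connectedComponentIn (tubeWalls (F : Set (E m)) v)ᶜ x) =
      connectedComponentIn (tubeWalls (F : Set (E m)) v)ᶜ x := by
  obtain ⟨L, μ, hμ, -, hL1, hL2, hform⟩ := aff_form h hw
  have hpar' : ∀ x (t : ℝ), w⁻¹ (x + t • v) = w⁻¹ x + t • v := by
    intro x t
    rw [Equiv.Perm.inv_eq_iff_eq, hpar, ← Equiv.Perm.mul_apply, mul_inv_cancel, Equiv.Perm.one_apply]
  have hFim : w '' (tubeWalls (F : Set (E m)) v)ᶜ = (tubeWalls (F : Set (E m)) v)ᶜ := by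
    apply Set.Subset.antisymm
    · rintro _ ⟨y, hy, rfl⟩
      exact tube_compl_map h hw hpar hy
    · intro y hy
      refine ⟨w⁻¹ y, tube_compl_map h (inv_mem hw) hpar' hy, ?_⟩
      rw [← Equiv.Perm.mul_apply, mul_inv_cancel, Equiv.Perm.one_apply]
  let e : E m ≃ₜ E m := L.toHomeomorph.trans (Homeomorph.addRight μ)
  have he : (e : E m → E m) = w := by
    ext1 y
    rw [hform]; rfl
  have := e.image_connectedComponentIn hx
  rw [he, hFim, hwx] at this
  rw [this]
  symm
  refine connectedComponentIn_eq ?_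
  have hpre : IsPreconnected (segment ℝ x (x + c • v)) := (convex_segment _ _).isPreconnected
  have hsub : segment ℝ x (x + c • v) ⊆ (tubeWalls (F : Set (E m)) v)ᶜ := by
    intro y hy hyw
    apply hx
    simp only [tubeWalls, Set.mem_iUnion] at hyw ⊢
    obtain ⟨α, ⟨hα, hαv⟩, k, hk⟩ := hyw
    refine ⟨α, ⟨hα, hαv⟩, k, ?_⟩
    rw [segment_eq_image'] at hy
    obtain ⟨θ, _, rfl⟩ := hy
    have hk' : ⟪α, x + θ • (x + c • v - x)⟫ = (k : ℝ) := hk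
    rw [add_sub_cancel_left, inner_add_right, real_inner_smul_right, real_inner_smul_right, hαv]
      at hk'
    show ⟪α, x⟫ = (k : ℝ)
    linarith
  exact hpre.subset_connectedComponentIn (left_mem_segment _ _ _) hsub (right_mem_segment _ _ _)

/-! ## Counting -/

lemma D_line (x v : E m) {a b : ℝ} (ha : 0 ≤ a) (hab : a ≤ b) :
    D F x (x + a • v) + D F (x + a • v) (x + b • v) = D F x (x + b • v) := by
  unfold D
  rw [← Finset.sum_add_distrib]
  refine Finset.sum_congr rfl fun β _ => ?_
  rw [inner_add_right, inner_add_right, real_inner_smul_right, real_inner_smul_right]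
  rcases le_total 0 ⟪β, v⟫ with hle | hle
  · have b1 := Int.floor_mono (show ⟪β, x⟫ ≤ ⟪β, x⟫ + a * ⟪β, v⟫ by nlinarith)
    have b2 := Int.floor_mono (show ⟪β, x⟫ + a * ⟪β, v⟫ ≤ ⟪β, x⟫ + b * ⟪β, v⟫ by nlinarith)
    rw [abs_of_nonpos (by linarith), abs_of_nonpos (by linarith), abs_of_nonpos (by linarith)]
    ring
  · have b1 := Int.floor_mono (show ⟪β, x⟫ + a * ⟪β, v⟫ ≤ ⟪β, x⟫ by nlinarith)
    have b2 := Int.floor_mono (show ⟪β, x⟫ + b * ⟪β, v⟫ ≤ ⟪β, x⟫ + a * ⟪β, v⟫ by nlinarith)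
    rw [abs_of_nonneg (by linarith), abs_of_nonneg (by linarith), abs_of_nonneg (by linarith)]
    ring

lemma D_pow (h : SubRS F) {w : Equiv.Perm (E m)} (hw : w ∈ Waff (F : Set (E m))) {x v : E m}
    {c : ℝ} (hc : 0 ≤ c) (hx : ∀ k : ℕ, (w ^ k) x = x + (k * c) • v) (k : ℕ) :
    D F x ((w ^ k) x) = k * D F x (w x) := by
  induction k with
  | zero => simpa using D_eq_zero.2 fun _ _ => rfl
  | succ k ih =>
    have h1 := D_line (F := F) x v (a := k * c) (b := ((k + 1 : ℕ) : ℝ) * c) (by positivity)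
      (mul_le_mul_of_nonneg_right (by push_cast; linarith) hc)
    rw [← hx, ← hx, ih, pow_succ, Equiv.Perm.mul_apply, D_map h (pow_mem hw k)] at h1
    rw [pow_succ, Equiv.Perm.mul_apply, ← h1]
    push_cast; ring

lemma D_approx (x v : E m) : abs ((D F x (x + v) : ℝ) - ∑ α ∈ F, abs ⟪α, v⟫) ≤ F.card := by
  unfold D
  push_cast
  rw [← Finset.sum_sub_distrib]
  refine (Finset.abs_sum_le_sum_abs _ _).trans ?_
  have : ∀ α ∈ F, abs (abs ((⌊⟪α, x⟫⌋ : ℝ) - (⌊⟪α, x + v⟫⌋ : ℝ)) - abs ⟪α, v⟫) ≤ 1 := by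
    intro α _
    rw [inner_add_right, ← abs_neg ⟪α, v⟫]
    refine (abs_abs_sub_abs_le _ _).trans ?_
    have a1 := Int.floor_le ⟪α, x⟫
    have a2 := Int.lt_floor_add_one ⟪α, x⟫
    have a3 := Int.floor_le (⟪α, x⟫ + ⟪α, v⟫)
    have a4 := Int.lt_floor_add_one (⟪α, x⟫ + ⟪α, v⟫)
    rw [abs_le]
    constructor <;> linarith
  refine (Finset.sum_le_sum this).trans ?_
  simp

lemma D_exact (h : SubRS F) {w : Equiv.Perm (E m)} (hw : w ∈ Waff (F : Set (E m))) {x v : E m}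
    {c : ℝ} (hc : 0 ≤ c) (hx : ∀ k : ℕ, (w ^ k) x = x + (k * c) • v) :
    (D F x (w x) : ℝ) = c * ∑ α ∈ F, |⟪α, v⟫| := by
  by_contra hne
  have hd : 0 < abs ((D F x (w x) : ℝ) - c * ∑ α ∈ F, abs ⟪α, v⟫) := abs_pos.2 (sub_ne_zero.2 hne)
  obtain ⟨k, hk⟩ := exists_nat_gt ((F.card : ℝ) / abs ((D F x (w x) : ℝ) - c * ∑ α ∈ F, abs ⟪α, v⟫))
  rw [div_lt_iff₀ hd] at hk
  have h1 := D_approx (F := F) x ((k * c) • v)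
  rw [← hx, D_pow h hw hc hx] at h1
  have h2 : ∑ α ∈ F, |⟪α, ((k : ℝ) * c) • v⟫| = k * (c * ∑ α ∈ F, |⟪α, v⟫|) := by
    rw [Finset.mul_sum, Finset.mul_sum]
    refine Finset.sum_congr rfl fun α _ => ?_
    rw [real_inner_smul_right, abs_mul, abs_mul, Nat.abs_cast, abs_of_nonneg hc]
    ring
  rw [h2] at h1
  push_cast at h1
  rw [← mul_sub, abs_mul, Nat.abs_cast] at h1
  linarith

lemma Ctx.sum_abs (h : Ctx F B ω αh) (i : Fin m) {P : Finset (E m)}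
    (hP : ∀ α, α ∈ P ↔ α ∈ F ∧ Pos ω α) : ∑ α ∈ F, |⟪α, ω i⟫| = 2 * ⟪∑ α ∈ P, α, ω i⟫ := by
  classical
  have hF : F = P ∪ P.image (fun α => -α) := by
    ext α
    simp only [Finset.mem_union, Finset.mem_image, hP]
    constructor
    · intro hα
      rcases h.pos_or_neg hα with hp | hp
      · exact Or.inl ⟨hα, hp⟩
      · exact Or.inr ⟨-α, ⟨h.neg hα, hp⟩, neg_neg α⟩
    · rintro (h1 | ⟨β, h1, rfl⟩)
      · exact h1.1
      · exact h.neg h1.1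
  have hdis : Disjoint P (P.image (fun α => -α)) := by
    rw [Finset.disjoint_left]
    intro α hα hα'
    obtain ⟨β, hβ, rfl⟩ := Finset.mem_image.1 hα'
    obtain ⟨j, hj⟩ := h.exists_pos_coeff ((hP _).1 hβ).1 ((hP _).1 hβ).2
    have := ((hP _).1 hα).2 j
    rw [inner_neg_left] at this
    linarith
  rw [hF, Finset.sum_union hdis, Finset.sum_image (fun a _ b _ hab => neg_injective hab), two_mul,
    sum_inner]
  congr 1 <;> refine Finset.sum_congr rfl fun α hα => ?_
  · exact abs_of_nonneg (((hP _).1 hα).2 i)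
  · rw [inner_neg_left, abs_neg]; exact abs_of_nonneg (((hP _).1 hα).2 i)

theorem main (h : Ctx F B ω αh) (i : Fin m) {P : Finset (E m)}
    (hP : ∀ α, α ∈ P ↔ α ∈ F ∧ Pos ω α) :
    ∃ u ∈ W0 (F : Set (E m)), ∃ T' : Set (E m), IsGeodesicTube (F : Set (E m)) (ω i) T' ∧
      ∃ w : Equiv.Perm (E m),
        IsHypGenerator (F : Set (E m)) ((u : Equiv.Perm (E m)) (ω i)) ((u : E m → E m) '' T') w ∧
        IsStraight (SAff B αh) w ∧
        ((len (SAff B αh) w : ℝ) =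
          ⟪ω i, coroot (B i)⟫ / ⟪ω i, ω i⟫ * ⟪∑ α ∈ P, α, ω i⟫) := by
  obtain ⟨w0, hw0, p, hp, hw0p, hpar0⟩ := h.axis i
  obtain ⟨l, hl, hC⟩ := h.exists_list_to_C hp
  have hgW := h.list_sub hl
  set g := l.prod with hg
  obtain ⟨K, κ, hκ, hKW, hK1, hK2, hgf⟩ := aff_form h.toSubRS hgW
  set c : ℝ := ⟪ω i, coroot (B i)⟫ / ⟪ω i, ω i⟫ with hcdef
  have hω0 : ω i ≠ 0 := by
    intro h0
    have := h.dual i i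
    rw [h0] at this
    simp at this
  have hc : 0 < c := by
    refine div_pos ?_ (real_inner_self_pos.2 hω0)
    rw [coroot, real_inner_smul_right, real_inner_comm (B i) (ω i), h.dual, if_pos rfl, mul_one]
    exact div_pos two_pos (real_inner_self_pos.2 (h.ne _ (h.memB i)))
  set β := K (ω i) with hβ
  have hβ0 : β ≠ 0 := by
    rw [hβ, Ne, LinearIsometryEquiv.map_eq_zero_iff]; exact hω0
  have hgpar : ∀ x (t : ℝ), g (x + t • ω i) = g x + t • β := by
    intro x t
    rw [hgf, hgf, map_add, map_smul]; abel
  have hginv : ∀ x (t : ℝ), g⁻¹ (x + t • β) = g⁻¹ x + t • ω i := by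
    intro x t
    rw [Equiv.Perm.inv_eq_iff_eq, hgpar, ← Equiv.Perm.mul_apply, mul_inv_cancel,
      Equiv.Perm.one_apply]
  set x0 := g p with hx0
  set w := g * w0 * g⁻¹ with hw
  have hwW : w ∈ Waff (F : Set (E m)) := mul_mem (mul_mem hgW hw0) (inv_mem hgW)
  have hwx0 : w x0 = x0 + c • β := by
    rw [hw, hx0, Equiv.Perm.mul_apply, ← Equiv.Perm.mul_apply g⁻¹, inv_mul_cancel,
      Equiv.Perm.one_apply, Equiv.Perm.mul_apply, hw0p, hgpar]
  have hwpar : ∀ x (t : ℝ), w (x + t • β) = w x + t • β := by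
    intro x t
    rw [hw, Equiv.Perm.mul_apply, Equiv.Perm.mul_apply, hginv, hpar0, hgpar]
    rfl
  have hwk : ∀ k : ℕ, (w ^ k) x0 = x0 + (k * c) • β := by
    intro k
    induction k with
    | zero => simp
    | succ k ih =>
      rw [pow_succ', Equiv.Perm.mul_apply, ih, hwpar, hwx0]
      push_cast; module
  set u : Equiv.Perm (E m) := K.toLinearEquiv.toEquiv with hu
  have huK : ∀ x, u x = K x := fun x => rfl
  have huinv : ∀ x, u⁻¹ x = K.symm x := fun x => rfl
  have huWaff : u ∈ Waff (F : Set (E m)) := by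
    refine (Subgroup.closure_mono ?_ : W0 (F : Set (E m)) ≤ _) hKW
    rintro _ ⟨α, hα, rfl⟩
    exact ⟨α, hα, 0, rfl⟩
  set q := u⁻¹ x0 with hq
  have hqReg : Reg F q := Reg.map h.toSubRS (inv_mem huWaff) (h.reg_InC hC)
  have hqT : q ∈ (tubeWalls (F : Set (E m)) (ω i))ᶜ := by
    intro hqw
    simp only [tubeWalls, Set.mem_iUnion] at hqw
    obtain ⟨α, ⟨hα, _⟩, k, hk⟩ := hqw
    exact hqReg α hα k hk
  set T := connectedComponentIn (tubeWalls (F : Set (E m)) (ω i))ᶜ q with hT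
  set w1 := u⁻¹ * w * u with hw1
  have hw1W : w1 ∈ Waff (F : Set (E m)) := mul_mem (mul_mem (inv_mem huWaff) hwW) huWaff
  have hw1par : ∀ x (t : ℝ), w1 (x + t • ω i) = w1 x + t • ω i := by
    intro x t
    rw [hw1]
    simp only [Equiv.Perm.mul_apply, huK, huinv]
    rw [map_add, map_smul, ← hβ, hwpar, map_add, map_smul, hβ, LinearIsometryEquiv.symm_apply_apply]
  have hw1q : w1 q = q + c • ω i := by
    rw [hw1, hq]
    simp only [Equiv.Perm.mul_apply, huK, huinv, LinearIsometryEquiv.apply_symm_apply]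
    rw [hwx0, map_add, map_smul, hβ, LinearIsometryEquiv.symm_apply_apply]
  have hw1T : w1 '' T = T := tube_image h.toSubRS hw1W hw1par hqT hw1q
  have hwT : w '' (u '' T) = u '' T := by
    conv_rhs => rw [← hw1T]
    rw [Set.image_image, Set.image_image]
    refine Set.image_congr fun x _ => ?_
    simp only [hw1, Equiv.Perm.mul_apply, huK, huinv, LinearIsometryEquiv.apply_symm_apply]
  obtain ⟨L, μ, hμ, -, hL1, hL2, hwf⟩ := aff_form h.toSubRS hwW
  have hLβ : L β = β := by
    have := hwpar 0 1
    rw [hwf, hwf] at this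
    simp only [one_smul, zero_add, map_zero] at this
    rw [add_comm μ] at this
    exact add_right_cancel this
  obtain ⟨hhyp, htrans⟩ := hyp_of_axis hwf hLβ hwx0 hc hβ0
  refine ⟨u, hKW, T, ⟨q, hqT, rfl⟩, w, ⟨⟨hwW, hhyp, hwT⟩, c, hc, htrans, ?_⟩, ?_, ?_⟩
  · rintro w' ⟨hw'W, hw'h, -⟩ c' hc' hc'0
    exact h.min_trans i hK2 hw'W hw'h hc' hc'0
  · intro k
    have h1 := D_pow h.toSubRS hwW hc.le hwk k
    rw [h.len_eq hC (pow_mem hwW k), h.len_eq hC hwW] at h1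
    have h2 : (len (SAff B αh) (w ^ k) : ℤ) = k * len (SAff B αh) w := by linarith
    exact_mod_cast h2
  · have h1 := D_exact h.toSubRS hwW hc.le hwk
    rw [h.len_eq hC hwW] at h1
    have h2 : ∑ α ∈ F, |⟪α, β⟫| = ∑ α ∈ F, |⟪α, ω i⟫| := by
      refine Finset.sum_nbij' (fun α => K.symm α) (fun α => K α) hK2 hK1 (by simp) (by simp) ?_
      intro α _
      rw [hβ, ← LinearIsometryEquiv.inner_map_map K (K.symm α), LinearIsometryEquiv.apply_symm_apply]
    rw [h2, h.sum_abs i hP] at h1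
    push_cast at h1
    linarith

end Tube

/-- For each `i`, there exists a geodesic tube of type `ω_i∨` (an image
under the finite Weyl group `W` of a geodesic tube of direction `ω_i∨`) whose hyperbolic
generator `w` is straight of length `((ω_i∨, α_i∨)/(ω_i∨, ω_i∨)) ⟨2ρ, ω_i∨⟩`. -/
theorem exists_tube_with_straight_generator {m : ℕ}
    (Φ : Set (E m)) (hΦ : IsRootSystem Φ)
    (B ω : Fin m → E m) (hB : IsSimpleSystem Φ B) (hω : IsFundamentalCoweights B ω)
    (αh : E m) (hαh : IsHighestRoot Φ B αh)
    (P : Finset (E m)) (hP : IsPositiveSystem Φ B P)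
    (ρ2 : E m) (hρ2 : ρ2 = ∑ α ∈ P, α)
    (i : Fin m) :
    ∃ u ∈ W0 Φ, ∃ T' : Set (E m), IsGeodesicTube Φ (ω i) T' ∧
      ∃ w : Equiv.Perm (E m),
        IsHypGenerator Φ ((u : Equiv.Perm (E m)) (ω i)) ((u : E m → E m) '' T') w ∧
        IsStraight (SAff B αh) w ∧
        ((len (SAff B αh) w : ℝ) = ⟪ω i, coroot (B i)⟫ / ⟪ω i, ω i⟫ * ⟪ρ2, ω i⟫) := by
  obtain ⟨F, rfl⟩ := hΦ.finite.exists_finset_coe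
  have h : Tube.Ctx F B ω αh := Tube.mkCtx hΦ hB hω hαh
  subst hρ2
  refine Tube.main h i fun α => ?_
  have h1 : α ∈ P ↔ α ∈ (P : Set (E m)) := Iff.rfl
  rw [h1, hP]
  constructor
  · rintro ⟨hα, c, hc, rfl⟩
    refine ⟨hα, fun j => ?_⟩
    rw [Tube.sum_coeff hω]; exact hc j
  · rintro ⟨hα, hp⟩
    exact ⟨hα, _, hp, h.expand α⟩

end
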